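/- arXiv:1705.08024 — 2 statements merged into one kernel-verified Lean document; each statement's English description precedes it below -/
import Mathlib

section
/- Let A be a finite-dimensional Z-graded K-algebra with triangular decomposition (A⁻,T,A⁺). The assignment λ ↦ L(λ) := Hd(Δ̄(λ)) is a bijection from isomorphism classes of simple graded T-modules to isomorphism classes of simple graded A-modules. -/
open scoped TensorProduct

universe u

namespace TriangularPaper

variable (K A : Type u) [Field K] [Ring A] [Algebra K A]

/-- The multiplication map `M ⊗ N → A` for two `K`-subspaces of `A`. -/
noncomputable def mulMap (M N : Submodule K A) : (↥M ⊗[K] ↥N) →ₗ[K] A :=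
  (LinearMap.mul' K A).comp (TensorProduct.map M.subtype N.subtype)

/-- The triple multiplication map `(P ⊗ Q) ⊗ R → A`. -/
noncomputable def triMulMap (P Q R : Submodule K A) :
    ((↥P ⊗[K] ↥Q) ⊗[K] ↥R) →ₗ[K] A :=
  (LinearMap.mul' K A).comp (TensorProduct.map (mulMap K A P Q) R.subtype)

/-- A triangular decomposition `(A⁻, T, A⁺)` of the finite-dimensional graded algebra `A`
with internal grading `𝒜`, in the sense of Holmes–Nakano. -/
structure TriangularDecomposition (𝒜 : ℤ → Submodule K A)
    (Am T Ap : Subalgebra K A) : Prop where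
  /-- `𝒜` is a grading of `A` -/
  internal : DirectSum.IsInternal 𝒜
  one_mem : (1 : A) ∈ 𝒜 0
  mul_mem : ∀ i j : ℤ, ∀ a b : A, a ∈ 𝒜 i → b ∈ 𝒜 j → a * b ∈ 𝒜 (i + j)
  /-- multiplication `A⁻ ⊗ T ⊗ A⁺ → A` is a linear isomorphism -/
  mul_bij : Function.Bijective (triMulMap K A Am.toSubmodule T.toSubmodule Ap.toSubmodule)
  /-- `T` is concentrated in degree `0` -/
  T_deg0 : T.toSubmodule ≤ 𝒜 0
  /-- `A⁻` is supported in nonpositive degrees -/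
  neg_supp : Am.toSubmodule ≤ ⨆ n : ℕ, 𝒜 (-(n : ℤ))
  /-- `A⁺` is supported in nonnegative degrees -/
  pos_supp : Ap.toSubmodule ≤ ⨆ n : ℕ, 𝒜 (n : ℤ)
  /-- `A⁻` is a graded subalgebra -/
  neg_graded : Am.toSubmodule = ⨆ i : ℤ, Am.toSubmodule ⊓ 𝒜 i
  /-- `A⁺` is a graded subalgebra -/
  pos_graded : Ap.toSubmodule = ⨆ i : ℤ, Ap.toSubmodule ⊓ 𝒜 i
  /-- `A⁻₀ = K` -/
  neg_deg0 : Am.toSubmodule ⊓ 𝒜 0 = Submodule.span K {(1 : A)}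
  /-- `A⁺₀ = K` -/
  pos_deg0 : Ap.toSubmodule ⊓ 𝒜 0 = Submodule.span K {(1 : A)}
  /-- `A⁺T = TA⁺` as subspaces of `A` -/
  comm_pos : Ap.toSubmodule * T.toSubmodule = T.toSubmodule * Ap.toSubmodule
  /-- `A⁻T = TA⁻` as subspaces of `A` -/
  comm_neg : Am.toSubmodule * T.toSubmodule = T.toSubmodule * Am.toSubmodule
  /-- `T` is a split `K`-algebra -/
  T_split : ∀ (V : Type u) [AddCommGroup V] [Module ↥T V], IsSimpleModule ↥T V →
    ∀ f : V →ₗ[↥T] V, ∃ c : K, ∀ v, f v = algebraMap K ↥T c • v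

/-- The negative Borel subalgebra `B⁻ = A⁻T` (as a subspace). -/
noncomputable def Bneg (Am T : Subalgebra K A) : Submodule K A :=
  Am.toSubmodule * T.toSubmodule

/-- The positive Borel subalgebra `B⁺ = A⁺T` (as a subspace). -/
noncomputable def Bpos (T Ap : Subalgebra K A) : Submodule K A :=
  Ap.toSubmodule * T.toSubmodule

/-- The augmentation ideal `J⁺` of the positive Borel subalgebra. -/
noncomputable def Jpos (𝒜 : ℤ → Submodule K A) (T Ap : Subalgebra K A) : Submodule K A :=
  ⨆ (i : ℤ) (_ : 0 < i), Bpos K A T Ap ⊓ 𝒜 i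

/-- The augmentation ideal `J⁻` of the negative Borel subalgebra. -/
noncomputable def Jneg (𝒜 : ℤ → Submodule K A) (Am T : Subalgebra K A) : Submodule K A :=
  ⨆ (i : ℤ) (_ : i < 0), Bneg K A Am T ⊓ 𝒜 i

/-- `(D, ι)` realizes the proper standard module `Δ̄(M) = A ⊗_{B⁺} Inf_T^{B⁺} M`,
expressed through its universal property `Hom_A(Δ̄(M), N) ≅ Hom_{B⁺}(Inf M, Res N)`. -/
def IsProperStandardFor (𝒜 : ℤ → Submodule K A) (T Ap : Subalgebra K A)
    (M : Type u) [AddCommGroup M] [Module ↥T M]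
    (D : Type u) [AddCommGroup D] [Module A D] (ι : M →+ D) : Prop :=
  (∀ (t : ↥T) (m : M), ι (t • m) = (t : A) • ι m) ∧
  (∀ a ∈ Jpos K A 𝒜 T Ap, ∀ m : M, a • ι m = 0) ∧
  ∀ (N : Type u) [AddCommGroup N] [Module A N] (f : M →+ N),
    (∀ (t : ↥T) (m : M), f (t • m) = (t : A) • f m) →
    (∀ a ∈ Jpos K A 𝒜 T Ap, ∀ m : M, a • f m = 0) →
    ∃! F : D →ₗ[A] N, ∀ m, F (ι m) = f m

/-- `(D, p)` realizes the proper costandard module `∇̄(M)`, expressed through its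
couniversal property `Hom_A(N, ∇̄(M)) ≅ Hom_{B⁻}(Res N, Inf M)`. -/
def IsProperCostandardFor (𝒜 : ℤ → Submodule K A) (Am T : Subalgebra K A)
    (M : Type u) [AddCommGroup M] [Module ↥T M]
    (D : Type u) [AddCommGroup D] [Module A D] (p : D →+ M) : Prop :=
  (∀ (t : ↥T) (x : D), p ((t : A) • x) = t • p x) ∧
  (∀ a ∈ Jneg K A 𝒜 Am T, ∀ x : D, p (a • x) = 0) ∧
  ∀ (N : Type u) [AddCommGroup N] [Module A N] (f : N →+ M),
    (∀ (t : ↥T) (x : N), f ((t : A) • x) = t • f x) →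
    (∀ a ∈ Jneg K A 𝒜 Am T, ∀ x : N, f (a • x) = 0) →
    ∃! F : N →ₗ[A] D, ∀ x, p (F x) = f x

/-- A compatible grading on an `A`-module `D`, making it an object of `𝒢(A)`. -/
def IsModuleGrading (𝒜 : ℤ → Submodule K A) {D : Type u} [AddCommGroup D] [Module A D]
    [Module K D] [IsScalarTower K A D] (ℳ : ℤ → Submodule K D) : Prop :=
  DirectSum.IsInternal ℳ ∧
    ∀ (i j : ℤ) (a : A) (x : D), a ∈ 𝒜 i → x ∈ ℳ j → a • x ∈ ℳ (i + j)

end TriangularPaper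

namespace TriangularPaper

variable (K A : Type u) [Field K] [Ring A] [Algebra K A]

/-- A submodule of a graded module is *graded* if it is generated by its homogeneous
elements. -/
def IsGradedSubmodule {S : Type u} [AddCommGroup S] [Module A S] [Module K S]
    [IsScalarTower K A S] (𝒮 : ℤ → Submodule K S) (N : Submodule A S) : Prop :=
  (N : Set S) ⊆ ↑(Submodule.span A (⋃ i : ℤ, (N : Set S) ∩ ↑(𝒮 i)))

/-- A nonzero graded module with no proper nonzero graded submodule. -/
def IsGradedSimple {S : Type u} [AddCommGroup S] [Module A S] [Module K S]
    [IsScalarTower K A S] (𝒮 : ℤ → Submodule K S) : Prop :=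
  Nontrivial S ∧ ∀ N : Submodule A S, IsGradedSubmodule K A 𝒮 N → N = ⊥ ∨ N = ⊤

/-- The full data exhibiting `(L, 𝒮) := (D/rad, ...)` as the simple head `L(λ)` of the
proper standard module `Δ̄(λ)` for the simple graded `T`-module `λ = (M, d)`. -/
def IsSimpleHeadData (𝒜 : ℤ → Submodule K A) (T Ap : Subalgebra K A) (d : ℤ)
    (M : Type u) [AddCommGroup M] [Module ↥T M]
    (D : Type u) [AddCommGroup D] [Module A D] [Module K D] [IsScalarTower K A D]
    (ι : M →+ D) (ℳ : ℤ → Submodule K D) (rad : Submodule A D) : Prop :=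
  IsSimpleModule ↥T M ∧
  IsProperStandardFor K A 𝒜 T Ap M D ι ∧
  IsModuleGrading K A 𝒜 ℳ ∧ (∀ m : M, ι m ∈ ℳ d) ∧
  rad ≠ ⊤ ∧ (∀ N : Submodule A D, N ≠ ⊤ → N ≤ rad)

section Gradings

variable {K A}
variable {𝒜 : ℤ → Submodule K A}

lemma exists_projections {V : Type*} [AddCommGroup V] [Module K V] {𝒱 : ℤ → Submodule K V}
    (h : DirectSum.IsInternal 𝒱) :
    ∃ π : ℤ → V →ₗ[K] V, (∀ i v, π i v ∈ 𝒱 i) ∧ (∀ i, ∀ v ∈ 𝒱 i, π i v = v) ∧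
      ∀ i j, i ≠ j → ∀ v ∈ 𝒱 j, π i v = 0 := by
  let _ := h.chooseDecomposition
  refine ⟨fun i => (𝒱 i).subtype ∘ₗ DirectSum.component K ℤ (fun i => 𝒱 i) i ∘ₗ
    (DirectSum.decomposeLinearEquiv 𝒱).toLinearMap, fun i v => ?_, fun i v hv => ?_,
    fun i j hij v hv => ?_⟩
  · simp
  · exact DirectSum.decompose_of_mem_same 𝒱 hv
  · exact DirectSum.decompose_of_mem_ne 𝒱 hv hij.symm

lemma isInternal_range {V : Type*} [AddCommGroup V] [Module K V] (p : ℤ → V →ₗ[K] V)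
    (hid : ∀ i x, p i (p i x) = p i x) (hzero : ∀ i j, i ≠ j → ∀ x, p i (p j x) = 0)
    (htop : ⨆ i, LinearMap.range (p i) = ⊤) :
    DirectSum.IsInternal fun i => LinearMap.range (p i) := by
  rw [DirectSum.isInternal_submodule_iff_iSupIndep_and_iSup_eq_top]
  refine ⟨fun i => ?_, htop⟩
  rw [Submodule.disjoint_def]
  rintro _ ⟨x, rfl⟩ hx
  have hle : ⨆ (j) (_ : j ≠ i), LinearMap.range (p j) ≤ LinearMap.ker (p i) := by
    refine iSup₂_le fun j hj => ?_
    rintro _ ⟨y, rfl⟩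
    exact hzero i j hj.symm y
  rw [← hid]
  exact hle hx

lemma exists_bound [FiniteDimensional K A] (h : DirectSum.IsInternal 𝒜) :
    ∃ B : ℤ, ∀ i, B < |i| → 𝒜 i = ⊥ := by
  have hfin : {i | 𝒜 i ≠ ⊥}.Finite :=
    WellFoundedGT.finite_ne_bot_of_iSupIndep h.submodule_iSupIndep
  obtain ⟨B, hB⟩ := (hfin.image fun i => |i|).bddAbove
  refine ⟨B, fun i hi => ?_⟩
  by_contra hne
  exact absurd (hB ⟨i, hne, rfl⟩) (not_le.mpr hi)

variable {W : Type u} [AddCommGroup W] [Module A W] [Module K W] [IsScalarTower K A W]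
  {𝒲 : ℤ → Submodule K W}

lemma proj_smul_of_mem_left (hW : IsModuleGrading K A 𝒜 𝒲) {π : ℤ → W →ₗ[K] W}
    (hid : ∀ i, ∀ v ∈ 𝒲 i, π i v = v) (hzero : ∀ i j, i ≠ j → ∀ v ∈ 𝒲 j, π i v = 0)
    {i : ℤ} {a : A} (ha : a ∈ 𝒜 i) (j : ℤ) (x : W) : π (i + j) (a • x) = a • π j x := by
  have hx : x ∈ ⨆ k, 𝒲 k := hW.1.submodule_iSup_eq_top ▸ Submodule.mem_top
  induction hx using Submodule.iSup_induction' with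
  | mem k x hx =>
    have hax := hW.2 i k a x ha hx
    by_cases hjk : j = k
    · subst hjk
      rw [hid _ _ hax, hid _ _ hx]
    · rw [hzero _ _ (by omega) _ hax, hzero _ _ hjk _ hx, smul_zero]
  | zero => simp
  | add x y _ _ hx hy => simp only [smul_add, map_add, hx, hy]

lemma proj_smul_of_mem_right (hA : DirectSum.IsInternal 𝒜) (hW : IsModuleGrading K A 𝒜 𝒲)
    {ρ : ℤ → A →ₗ[K] A}
    (hρid : ∀ i, ∀ v ∈ 𝒜 i, ρ i v = v) (hρzero : ∀ i j, i ≠ j → ∀ v ∈ 𝒜 j, ρ i v = 0)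
    {π : ℤ → W →ₗ[K] W}
    (hid : ∀ i, ∀ v ∈ 𝒲 i, π i v = v) (hzero : ∀ i j, i ≠ j → ∀ v ∈ 𝒲 j, π i v = 0)
    {j : ℤ} {x : W} (hx : x ∈ 𝒲 j) (i : ℤ) (a : A) : π (i + j) (a • x) = ρ i a • x := by
  have ha : a ∈ ⨆ k, 𝒜 k := hA.submodule_iSup_eq_top ▸ Submodule.mem_top
  induction ha using Submodule.iSup_induction' with
  | mem k a ha =>
    have hax := hW.2 k j a x ha hx
    by_cases hik : i = k
    · subst hik
      rw [hid _ _ hax, hρid _ _ ha]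
    · rw [hzero _ _ (by omega) _ hax, hρzero _ _ hik _ ha, zero_smul]
  | zero => simp
  | add a b _ _ ha hb => simp only [add_smul, map_add, ha, hb]

/-- A surjective `A`-linear map that respects the degree of a set of homogeneous generators
respects the gradings. -/
lemma image_grading_eq (hA : DirectSum.IsInternal 𝒜)
    {M : Type*} [AddCommGroup M] {ι : M →+ W} (hgen : Submodule.span A (Set.range ι) = ⊤)
    (hW : IsModuleGrading K A 𝒜 𝒲) {d : ℤ} (hd : ∀ m, ι m ∈ 𝒲 d)
    {V : Type u} [AddCommGroup V] [Module A V] [Module K V] [IsScalarTower K A V]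
    {𝒱 : ℤ → Submodule K V} (hV : IsModuleGrading K A 𝒜 𝒱) (F : W →ₗ[A] V)
    (hF : ∀ m, F (ι m) ∈ 𝒱 d) (hsurj : Function.Surjective F) (i : ℤ) :
    F '' (𝒲 i : Set W) = 𝒱 i := by
  obtain ⟨ρ, -, hρid, hρzero⟩ := exists_projections hA
  obtain ⟨π, hπmem, hπid, hπzero⟩ := exists_projections hW.1
  obtain ⟨σ, hσmem, hσid, hσzero⟩ := exists_projections hV.1
  have key : ∀ x, F (π i x) = σ i (F x) := by
    intro x
    have hx : x ∈ Submodule.span A (Set.range ι) := hgen ▸ Submodule.mem_top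
    induction hx using Submodule.closure_induction with
    | zero => simp
    | add x y _ _ hx hy => simp only [map_add, hx, hy]
    | smul_mem a x hx =>
      obtain ⟨m, rfl⟩ := hx
      have h1 := proj_smul_of_mem_right hA hW hρid hρzero hπid hπzero (hd m) (i - d) a
      have h2 := proj_smul_of_mem_right hA hV hρid hρzero hσid hσzero (hF m) (i - d) a
      rw [sub_add_cancel] at h1 h2
      rw [h1, map_smul, map_smul, h2]
  ext y
  constructor
  · rintro ⟨x, hx, rfl⟩
    rw [← hπid i x hx, key]
    exact hσmem _ _
  · intro hy
    obtain ⟨x, rfl⟩ := hsurj y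
    exact ⟨π i x, hπmem _ _, by rw [key, hσid _ _ hy]⟩

end Gradings

section HighestWeight

variable {K A}
variable {𝒜 : ℤ → Submodule K A} {Am T Ap : Subalgebra K A}

/-- The additive subgroup spanned by the translates of the image of `f` under homogeneous
elements of negative degree. -/
def lowerPart (𝒜 : ℤ → Submodule K A) {M W : Type*} [AddCommGroup M] [AddCommGroup W]
    [Module A W] (f : M →+ W) : AddSubgroup W :=
  AddSubgroup.closure {x | ∃ j < 0, ∃ b ∈ 𝒜 j, ∃ m, x = b • f m}

lemma map_mem_lowerPart {M W V : Type*} [AddCommGroup M] [AddCommGroup W] [Module A W]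
    [AddCommGroup V] [Module A V] {f : M →+ W} (G : W →ₗ[A] V) {z : W}
    (hz : z ∈ lowerPart 𝒜 f) : G z ∈ lowerPart 𝒜 (G.toAddMonoidHom.comp f) := by
  induction hz using AddSubgroup.closure_induction with
  | mem x hx =>
    obtain ⟨j, hj, b, hb, m, rfl⟩ := hx
    exact AddSubgroup.subset_closure ⟨j, hj, b, hb, m, map_smul G b (f m)⟩
  | zero => rw [map_zero]; exact zero_mem _
  | add x y _ _ hx hy => rw [map_add]; exact add_mem hx hy
  | neg x _ hx => rw [map_neg]; exact neg_mem hx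

lemma smul_mem_lowerPart
    (hmul : ∀ i j : ℤ, ∀ a b : A, a ∈ 𝒜 i → b ∈ 𝒜 j → a * b ∈ 𝒜 (i + j))
    {M W : Type*} [AddCommGroup M] [AddCommGroup W] [Module A W] {f : M →+ W} {a : A}
    (ha : a ∈ 𝒜 0) {z : W} (hz : z ∈ lowerPart 𝒜 f) : a • z ∈ lowerPart 𝒜 f := by
  induction hz using AddSubgroup.closure_induction with
  | mem x hx =>
    obtain ⟨j, hj, b, hb, m, rfl⟩ := hx
    exact AddSubgroup.subset_closure
      ⟨0 + j, by omega, a * b, hmul _ _ _ _ ha hb, m, (mul_smul a b (f m)).symm⟩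
  | zero => rw [smul_zero]; exact zero_mem _
  | add x y _ _ hx hy => rw [smul_add]; exact add_mem hx hy
  | neg x _ hx => rw [smul_neg]; exact neg_mem hx

lemma TriangularDecomposition.smul_mem_range_sup (h : TriangularDecomposition K A 𝒜 Am T Ap)
    {M W : Type*} [AddCommGroup M] [Module ↥T M] [AddCommGroup W] [Module A W] {f : M →+ W}
    (hT : ∀ (t : ↥T) (m : M), f (t • m) = (t : A) • f m)
    (hJ : ∀ a ∈ Jpos K A 𝒜 T Ap, ∀ m : M, a • f m = 0) (a : A) (m : M) :
    a • f m ∈ f.range ⊔ lowerPart 𝒜 f := by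
  obtain ⟨π, -, hid, hzero⟩ := exists_projections h.internal
  have hscalar : ∀ r ∈ Submodule.span K {(1 : A)}, ∀ m, r • f m ∈ f.range := by
    intro r hr m
    obtain ⟨c, rfl⟩ := Submodule.mem_span_singleton.mp hr
    refine ⟨algebraMap K ↥T c • m, ?_⟩
    rw [hT, Algebra.algebraMap_eq_smul_one]
    rfl
  have hpos : ∀ r ∈ Ap, ∀ m, r • f m ∈ f.range := by
    intro r hr m
    have hr' : r ∈ ⨆ i : ℤ, Ap.toSubmodule ⊓ 𝒜 i := h.pos_graded ▸ hr
    clear hr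
    induction hr' using Submodule.iSup_induction' with
    | mem i r hri =>
      rcases lt_trichotomy i 0 with hi | rfl | hi
      · have hker : ⨆ n : ℕ, 𝒜 (n : ℤ) ≤ LinearMap.ker (π i) :=
          iSup_le fun n x hx => hzero i n (by omega) x hx
        have h0 : r = 0 := by
          rw [← hid i r hri.2]
          exact hker (h.pos_supp hri.1)
        rw [h0, zero_smul]
        exact zero_mem _
      · exact hscalar r (h.pos_deg0 ▸ hri) m
      · rw [hJ r (Submodule.mem_iSup_of_mem i (Submodule.mem_iSup_of_mem hi ⟨?_, hri.2⟩)) m]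
        · exact zero_mem _
        · rw [← mul_one r]
          exact Submodule.mul_mem_mul hri.1 T.one_mem
    | zero => simp
    | add x y _ _ hx hy => rw [add_smul]; exact add_mem hx hy
  have hneg : ∀ r ∈ Am, ∀ m, r • f m ∈ f.range ⊔ lowerPart 𝒜 f := by
    intro r hr m
    have hr' : r ∈ ⨆ i : ℤ, Am.toSubmodule ⊓ 𝒜 i := h.neg_graded ▸ hr
    clear hr
    induction hr' using Submodule.iSup_induction' with
    | mem i r hri =>
      rcases lt_trichotomy i 0 with hi | rfl | hi
      · exact AddSubgroup.mem_sup_right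
          (AddSubgroup.subset_closure ⟨i, hi, r, hri.2, m, rfl⟩)
      · exact AddSubgroup.mem_sup_left (hscalar r (h.neg_deg0 ▸ hri) m)
      · have hker : ⨆ n : ℕ, 𝒜 (-(n : ℤ)) ≤ LinearMap.ker (π i) :=
          iSup_le fun n x hx => hzero i _ (by omega) x hx
        have h0 : r = 0 := by
          rw [← hid i r hri.2]
          exact hker (h.neg_supp hri.1)
        rw [h0, zero_smul]
        exact zero_mem _
    | zero => simp
    | add x y _ _ hx hy => rw [add_smul]; exact add_mem hx hy
  obtain ⟨z, rfl⟩ := h.mul_bij.2 a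
  induction z with
  | zero => simp
  | add x y hx hy => rw [map_add, add_smul]; exact add_mem hx hy
  | tmul z r =>
    induction z with
    | zero => simp
    | add x y hx hy =>
      rw [TensorProduct.add_tmul, map_add, add_smul]
      exact add_mem hx hy
    | tmul p q =>
      have hpqr : triMulMap K A Am.toSubmodule T.toSubmodule Ap.toSubmodule
          ((p ⊗ₜ[K] q) ⊗ₜ[K] r) = p * q * r := by
        simp [triMulMap, mulMap]
      obtain ⟨m', hm'⟩ := hpos r r.2 m
      rw [hpqr, mul_assoc, mul_smul, mul_smul, ← hm', ← hT ⟨q, q.2⟩]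
      exact hneg p p.2 _

lemma TriangularDecomposition.range_sup_lowerPart
    (h : TriangularDecomposition K A 𝒜 Am T Ap)
    {M W : Type*} [AddCommGroup M] [Module ↥T M] [AddCommGroup W] [Module A W] {f : M →+ W}
    (hT : ∀ (t : ↥T) (m : M), f (t • m) = (t : A) • f m)
    (hJ : ∀ a ∈ Jpos K A 𝒜 T Ap, ∀ m : M, a • f m = 0)
    {x : W} (hx : x ∈ Submodule.span A (Set.range f)) :
    ∃ m, ∃ z ∈ lowerPart 𝒜 f, f m + z = x := by
  have hx' : x ∈ f.range ⊔ lowerPart 𝒜 f := by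
    induction hx using Submodule.closure_induction with
    | zero => exact zero_mem _
    | add x y _ _ hx hy => exact add_mem hx hy
    | smul_mem a x hx =>
      obtain ⟨m, rfl⟩ := hx
      exact h.smul_mem_range_sup hT hJ a m
  obtain ⟨_, ⟨m, rfl⟩, z, hz, e⟩ := AddSubgroup.mem_sup.mp hx'
  exact ⟨m, z, hz, e⟩

variable {W : Type u} [AddCommGroup W] [Module A W] [Module K W] [IsScalarTower K A W]
  {𝒲 : ℤ → Submodule K W}

lemma proj_eq_zero_of_mem_lowerPart (hW : IsModuleGrading K A 𝒜 𝒲) {π : ℤ → W →ₗ[K] W}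
    (hzero : ∀ i j, i ≠ j → ∀ v ∈ 𝒲 j, π i v = 0) {M : Type*} [AddCommGroup M] {f : M →+ W}
    {d : ℤ} (hd : ∀ m, f m ∈ 𝒲 d) {i : ℤ} (hi : d ≤ i) {z : W} (hz : z ∈ lowerPart 𝒜 f) :
    π i z = 0 := by
  induction hz using AddSubgroup.closure_induction with
  | mem x hx =>
    obtain ⟨j, hj, b, hb, m, rfl⟩ := hx
    exact hzero _ _ (by omega) _ (hW.2 j d b _ hb (hd m))
  | zero => simp
  | add x y _ _ hx hy => rw [map_add, hx, hy, add_zero]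
  | neg x _ hx => rw [map_neg, hx, neg_zero]

/-- Highest weight modules live in degrees at most `d`, and their degree `d` part is the
generating `T`-module. -/
lemma TriangularDecomposition.top_degree (h : TriangularDecomposition K A 𝒜 Am T Ap)
    (hW : IsModuleGrading K A 𝒜 𝒲) {M : Type*} [AddCommGroup M] [Module ↥T M] {f : M →+ W}
    (hT : ∀ (t : ↥T) (m : M), f (t • m) = (t : A) • f m)
    (hJ : ∀ a ∈ Jpos K A 𝒜 T Ap, ∀ m : M, a • f m = 0)
    (hgen : Submodule.span A (Set.range f) = ⊤) {d : ℤ} (hd : ∀ m, f m ∈ 𝒲 d) :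
    (∀ i, d < i → 𝒲 i = ⊥) ∧ (𝒲 d : Set W) = Set.range f := by
  obtain ⟨π, -, hid, hzero⟩ := exists_projections hW.1
  have key : ∀ i, d ≤ i → ∀ x ∈ 𝒲 i, ∃ m, x = π i (f m) := by
    intro i hi x hx
    obtain ⟨m, z, hz, rfl⟩ := h.range_sup_lowerPart hT hJ (x := x) (hgen ▸ Submodule.mem_top)
    refine ⟨m, ?_⟩
    rw [← hid i _ hx, map_add, proj_eq_zero_of_mem_lowerPart hW hzero hd hi hz, add_zero]
  refine ⟨fun i hi => ?_, ?_⟩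
  · rw [Submodule.eq_bot_iff]
    intro x hx
    obtain ⟨m, rfl⟩ := key i hi.le x hx
    exact hzero _ _ hi.ne' _ (hd m)
  · ext x
    constructor
    · intro hx
      obtain ⟨m, rfl⟩ := key d le_rfl x hx
      exact ⟨m, (hid _ _ (hd m)).symm⟩
    · rintro ⟨m, rfl⟩
      exact hd m

/-- Nakayama's lemma: a submodule that meets every coset of the lower part is everything. -/
lemma eq_top_of_forall_add_mem [FiniteDimensional K A]
    (hA : DirectSum.IsInternal 𝒜) (hone : (1 : A) ∈ 𝒜 0)
    (hmul : ∀ i j : ℤ, ∀ a b : A, a ∈ 𝒜 i → b ∈ 𝒜 j → a * b ∈ 𝒜 (i + j))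
    {M V : Type*} [AddCommGroup M] [AddCommGroup V] [Module A V] {f : M →+ V}
    (hgen : Submodule.span A (Set.range f) = ⊤) (N : Submodule A V)
    (hN : ∀ m, ∃ z ∈ lowerPart 𝒜 f, f m + z ∈ N) : N = ⊤ := by
  obtain ⟨B, hB⟩ := exists_bound hA
  have key : ∀ n : ℕ, ∀ j : ℤ, j ≤ n - |B| - 1 → j ≤ 0 → ∀ a ∈ 𝒜 j, ∀ m, a • f m ∈ N := by
    intro n
    induction n with
    | zero =>
      intro j hj hj0 a ha m
      have : 𝒜 j = ⊥ := hB j (by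
        have := le_abs_self B
        rw [abs_of_nonpos hj0]
        push_cast at hj
        omega)
      rw [this, Submodule.mem_bot] at ha
      rw [ha, zero_smul]
      exact zero_mem _
    | succ n ih =>
      intro j hj hj0 a ha m
      obtain ⟨z, hz, hmz⟩ := hN m
      have haz : a • z ∈ N := by
        clear hmz
        induction hz using AddSubgroup.closure_induction with
        | mem x hx =>
          obtain ⟨k, hk, b, hb, m', rfl⟩ := hx
          rw [← mul_smul]
          exact ih (j + k) (by push_cast at hj; omega) (by omega) _ (hmul _ _ _ _ ha hb) m'
        | zero => simp
        | add x y _ _ hx hy => rw [smul_add]; exact add_mem hx hy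
        | neg x _ hx => rw [smul_neg]; exact neg_mem hx
      have := N.sub_mem (N.smul_mem a hmz) haz
      rwa [smul_add, add_sub_cancel_right] at this
  rw [eq_top_iff, ← hgen, Submodule.span_le]
  rintro _ ⟨m, rfl⟩
  have := key (|B|.toNat + 1) 0 (by have := abs_nonneg B; push_cast; omega) le_rfl 1 hone m
  rwa [one_smul] at this

end HighestWeight

section ProperStandard

variable {K A}
variable {𝒜 : ℤ → Submodule K A} {Am T Ap : Subalgebra K A}

lemma IsProperStandardFor.hom_ext {M D : Type u} [AddCommGroup M] [Module ↥T M]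
    [AddCommGroup D] [Module A D] {ι : M →+ D} (hD : IsProperStandardFor K A 𝒜 T Ap M D ι)
    {N : Type u} [AddCommGroup N] [Module A N] {F G : D →ₗ[A] N}
    (hFG : ∀ m, F (ι m) = G (ι m)) : F = G := by
  obtain ⟨hT, hJ, hU⟩ := hD
  refine (hU N (G.toAddMonoidHom.comp ι) (fun t m => ?_) fun a ha m => ?_).unique hFG
    fun m => rfl
  · simp [hT]
  · simp [← map_smul, hJ a ha m]

lemma IsProperStandardFor.span_eq_top {M D : Type u} [AddCommGroup M] [Module ↥T M]
    [AddCommGroup D] [Module A D] {ι : M →+ D} (hD : IsProperStandardFor K A 𝒜 T Ap M D ι) :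
    Submodule.span A (Set.range ι) = ⊤ := by
  rw [← Submodule.ker_mkQ (Submodule.span A (Set.range ι)), LinearMap.ker_eq_top]
  refine hD.hom_ext fun m => ?_
  simpa using Submodule.subset_span (Set.mem_range_self m)

lemma IsProperStandardFor.exists_hom {M D : Type u} [AddCommGroup M] [Module ↥T M]
    [AddCommGroup D] [Module A D] {ι : M →+ D} (hD : IsProperStandardFor K A 𝒜 T Ap M D ι)
    {M' D' : Type u} [AddCommGroup M'] [Module ↥T M']
    [AddCommGroup D'] [Module A D'] {ι' : M' →+ D'}
    (hD' : IsProperStandardFor K A 𝒜 T Ap M' D' ι') (φ : M →ₗ[↥T] M') :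
    ∃ F : D →ₗ[A] D', ∀ m, F (ι m) = ι' (φ m) :=
  (hD.2.2 D' (ι'.comp φ.toAddMonoidHom) (fun t m => by simp [hD'.1])
    fun a ha m => hD'.2.1 a ha _).exists

lemma IsProperStandardFor.exists_equiv {M D : Type u} [AddCommGroup M] [Module ↥T M]
    [AddCommGroup D] [Module A D] {ι : M →+ D} (hD : IsProperStandardFor K A 𝒜 T Ap M D ι)
    {M' D' : Type u} [AddCommGroup M'] [Module ↥T M']
    [AddCommGroup D'] [Module A D'] {ι' : M' →+ D'}
    (hD' : IsProperStandardFor K A 𝒜 T Ap M' D' ι') (φ : M ≃ₗ[↥T] M') :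
    ∃ E : D ≃ₗ[A] D', ∀ m, E (ι m) = ι' (φ m) := by
  obtain ⟨F, hF⟩ := hD.exists_hom hD' φ.toLinearMap
  obtain ⟨G, hG⟩ := hD'.exists_hom hD φ.symm.toLinearMap
  refine ⟨LinearEquiv.ofLinearMap F G (hD'.hom_ext fun m => ?_) (hD.hom_ext fun m => ?_), hF⟩
  · simp [hF, hG]
  · simp [hF, hG]

/-- Relations imposed on the free `A`-module on `M` to obtain the proper standard module. -/
def standardRelations (𝒜 : ℤ → Submodule K A) (T Ap : Subalgebra K A)
    (M : Type u) [AddCommGroup M] [Module ↥T M] : Set (M →₀ A) :=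
  {x | (∃ m n : M, x = .single (m + n) 1 - .single m 1 - .single n 1) ∨
    (∃ (t : ↥T) (m : M), x = .single (t • m) 1 - .single m (t : A)) ∨
    ∃ i > 0, ∃ b ∈ Bpos K A T Ap ⊓ 𝒜 i, ∃ m : M, x = .single m b}

lemma isModuleGrading_self (hA : DirectSum.IsInternal 𝒜)
    (hmul : ∀ i j : ℤ, ∀ a b : A, a ∈ 𝒜 i → b ∈ 𝒜 j → a * b ∈ 𝒜 (i + j)) :
    IsModuleGrading K A 𝒜 𝒜 :=
  ⟨hA, hmul⟩

lemma mapRange_mem_span_standardRelations (hA : DirectSum.IsInternal 𝒜)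
    (hmul : ∀ i j : ℤ, ∀ a b : A, a ∈ 𝒜 i → b ∈ 𝒜 j → a * b ∈ 𝒜 (i + j))
    (hT : T.toSubmodule ≤ 𝒜 0) {ρ : ℤ → A →ₗ[K] A} (hid : ∀ i, ∀ v ∈ 𝒜 i, ρ i v = v)
    (hzero : ∀ i j, i ≠ j → ∀ v ∈ 𝒜 j, ρ i v = 0)
    {M : Type u} [AddCommGroup M] [Module ↥T M] (i : ℤ) {x : M →₀ A}
    (hx : x ∈ Submodule.span A (standardRelations 𝒜 T Ap M)) :
    Finsupp.mapRange.linearMap (ρ i) x ∈ Submodule.span A (standardRelations 𝒜 T Ap M) := by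
  have hρ : ∀ {j : ℤ} {b : A}, b ∈ 𝒜 j → ∀ (i : ℤ) (a : A), ρ (i + j) (a * b) = ρ i a * b :=
    fun hb => proj_smul_of_mem_right hA (isModuleGrading_self hA hmul) hid hzero hid hzero hb
  induction hx using Submodule.closure_induction with
  | zero => simp
  | add x y _ _ hx hy => rw [map_add]; exact add_mem hx hy
  | smul_mem a x hx =>
    obtain ⟨j, hj⟩ : ∃ j, Finsupp.mapRange.linearMap (ρ i) (a • x) = ρ j a • x := by
      rcases hx with ⟨m, n, rfl⟩ | ⟨t, m, rfl⟩ | ⟨k, -, b, hb, m, rfl⟩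
      · exact ⟨i, by simp only [smul_sub, Finsupp.smul_single, smul_eq_mul, mul_one, map_sub,
          Finsupp.mapRange.linearMap_apply, Finsupp.mapRange_single]⟩
      · have := hρ (hT t.2) i a
        rw [add_zero] at this
        exact ⟨i, by simp only [smul_sub, Finsupp.smul_single, smul_eq_mul, mul_one, map_sub,
          Finsupp.mapRange.linearMap_apply, Finsupp.mapRange_single, this]⟩
      · have := hρ hb.2 (i - k) a
        rw [sub_add_cancel] at this
        exact ⟨i - k, by simp only [Finsupp.smul_single, smul_eq_mul,
          Finsupp.mapRange.linearMap_apply, Finsupp.mapRange_single, this]⟩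
    rw [hj]
    exact Submodule.smul_mem _ _ (Submodule.subset_span hx)

/-- Existence of the proper standard module, with its homogeneous projections. -/
lemma exists_properStandard (hA : DirectSum.IsInternal 𝒜)
    (hmul : ∀ i j : ℤ, ∀ a b : A, a ∈ 𝒜 i → b ∈ 𝒜 j → a * b ∈ 𝒜 (i + j))
    (hT : T.toSubmodule ≤ 𝒜 0) {ρ : ℤ → A →ₗ[K] A} (hid : ∀ i, ∀ v ∈ 𝒜 i, ρ i v = v)
    (hzero : ∀ i j, i ≠ j → ∀ v ∈ 𝒜 j, ρ i v = 0)
    (M : Type u) [AddCommGroup M] [Module ↥T M] :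
    ∃ (D : Type u) (_ : AddCommGroup D) (_ : Module A D) (_ : Module K D)
      (_ : IsScalarTower K A D) (ι : M →+ D) (p : ℤ → D →ₗ[K] D),
      IsProperStandardFor K A 𝒜 T Ap M D ι ∧ ∀ i a m, p i (a • ι m) = ρ i a • ι m := by
  let R := Submodule.span A (standardRelations 𝒜 T Ap M)
  let ι : M →+ (M →₀ A) ⧸ R := AddMonoidHom.mk' (fun m => R.mkQ (.single m 1)) fun m n => by
    rw [← sub_eq_zero, ← sub_sub, ← map_sub, ← map_sub]
    exact (Submodule.Quotient.mk_eq_zero R).mpr (Submodule.subset_span (.inl ⟨m, n, rfl⟩))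
  have hsmul : ∀ (a : A) (m : M), a • ι m = R.mkQ (.single m a) := by
    intro a m
    change a • R.mkQ _ = _
    rw [← map_smul, Finsupp.smul_single, smul_eq_mul, mul_one]
  let e := Submodule.Quotient.restrictScalarsEquiv K R
  let p : ℤ → ((M →₀ A) ⧸ R) →ₗ[K] ((M →₀ A) ⧸ R) := fun i =>
    e.toLinearMap ∘ₗ Submodule.mapQ (R.restrictScalars K) (R.restrictScalars K)
      (Finsupp.mapRange.linearMap (ρ i))
      (fun x hx => mapRange_mem_span_standardRelations hA hmul hT hid hzero i hx) ∘ₗ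
      e.symm.toLinearMap
  refine ⟨(M →₀ A) ⧸ R, inferInstance, inferInstance, inferInstance, inferInstance, ι, p,
    ⟨fun t m => ?_, fun a ha m => ?_, fun N _ _ f hfT hfJ => ?_⟩, fun i a m => ?_⟩
  · rw [hsmul, ← sub_eq_zero]
    change R.mkQ _ - _ = _
    rw [← map_sub]
    exact (Submodule.Quotient.mk_eq_zero R).mpr
      (Submodule.subset_span (.inr (.inl ⟨t, m, rfl⟩)))
  · have hle : Jpos K A 𝒜 T Ap ≤
        LinearMap.ker ((LinearMap.toSpanSingleton A _ (ι m)).restrictScalars K) := by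
      refine iSup₂_le fun i hi b hb => ?_
      change b • ι m = 0
      rw [hsmul]
      exact (Submodule.Quotient.mk_eq_zero R).mpr
        (Submodule.subset_span (.inr (.inr ⟨i, hi, b, hb, m, rfl⟩)))
    exact hle ha
  · have hR : R ≤ LinearMap.ker (Finsupp.lsum ℕ fun m => LinearMap.toSpanSingleton A N (f m)) := by
      refine Submodule.span_le.mpr ?_
      rintro _ (⟨m, n, rfl⟩ | ⟨t, m, rfl⟩ | ⟨i, hi, b, hb, m, rfl⟩)
      · simp only [SetLike.mem_coe, LinearMap.mem_ker, map_sub, Finsupp.lsum_single,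
          LinearMap.toSpanSingleton_apply, one_smul, map_add]
        abel
      · simp only [SetLike.mem_coe, LinearMap.mem_ker, map_sub, Finsupp.lsum_single,
          LinearMap.toSpanSingleton_apply, one_smul, hfT, sub_self]
      · have : b ∈ Jpos K A 𝒜 T Ap :=
          Submodule.mem_iSup_of_mem i (Submodule.mem_iSup_of_mem hi hb)
        simpa using hfJ b this m
    refine ⟨R.liftQ _ hR, fun m => ?_, fun G hG => ?_⟩
    · change R.liftQ _ hR (R.mkQ _) = _
      simp
    · refine Submodule.linearMap_qext _ (Finsupp.lhom_ext fun m a => ?_)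
      rw [LinearMap.comp_apply, LinearMap.comp_apply, ← hsmul, map_smul, hG, hsmul]
      simp
  · rw [hsmul, hsmul]
    change R.mkQ (Finsupp.mapRange.linearMap (ρ i) _) = _
    simp

/-- Existence of the proper standard module as a graded module. -/
lemma TriangularDecomposition.exists_graded_properStandard
    (h : TriangularDecomposition K A 𝒜 Am T Ap) (d : ℤ)
    (M : Type u) [AddCommGroup M] [Module ↥T M] :
    ∃ (D : Type u) (_ : AddCommGroup D) (_ : Module A D) (_ : Module K D)
      (_ : IsScalarTower K A D) (ι : M →+ D) (ℳ : ℤ → Submodule K D),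
      IsProperStandardFor K A 𝒜 T Ap M D ι ∧ IsModuleGrading K A 𝒜 ℳ ∧
        ∀ m, ι m ∈ ℳ d := by
  obtain ⟨ρ, hmem, hid, hzero⟩ := exists_projections h.internal
  obtain ⟨D, _, _, _, _, ι, p, hD, hp⟩ :=
    exists_properStandard (Ap := Ap) h.internal h.mul_mem h.T_deg0 hid hzero M
  have hρ : ∀ {i : ℤ} {a : A}, a ∈ 𝒜 i → ∀ j b, ρ (i + j) (a * b) = a * ρ j b :=
    fun ha => proj_smul_of_mem_left (isModuleGrading_self h.internal h.mul_mem) hid hzero ha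
  have hgen := hD.span_eq_top
  have hind : ∀ {P : D → Prop}, P 0 → (∀ x y, P x → P y → P (x + y)) →
      (∀ (a : A) m, P (a • ι m)) → ∀ x, P x := by
    intro P h0 hadd hsm x
    have hx : x ∈ Submodule.span A (Set.range ι) := hgen ▸ Submodule.mem_top
    induction hx using Submodule.closure_induction with
    | zero => exact h0
    | add x y _ _ hx hy => exact hadd x y hx hy
    | smul_mem a x hx =>
      obtain ⟨m, rfl⟩ := hx
      exact hsm a m
  have hpp : ∀ i x, p i (p i x) = p i x := fun i =>
    hind (by simp) (fun x y hx hy => by simp only [map_add, hx, hy]) fun a m => by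
      rw [hp, hp, hid _ _ (hmem i a)]
  have hpp' : ∀ i j, i ≠ j → ∀ x, p i (p j x) = 0 := fun i j hij =>
    hind (by simp) (fun x y hx hy => by simp only [map_add, hx, hy, add_zero]) fun a m => by
      rw [hp, hp, hzero _ _ hij _ (hmem j a), zero_smul]
  have hpsmul : ∀ {i : ℤ} {a : A}, a ∈ 𝒜 i → ∀ j x, p (i + j) (a • x) = a • p j x :=
    fun {i a} ha j => hind (by simp) (fun x y hx hy => by simp only [smul_add, map_add, hx, hy])
      fun b m => by rw [← mul_smul, hp, hp, hρ ha, mul_smul]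
  have htop : ⨆ i, LinearMap.range (p i) = ⊤ := by
    refine eq_top_iff.mpr fun x _ => hind (zero_mem _) (fun x y => add_mem) (fun a m => ?_) x
    have ha : a ∈ ⨆ k, 𝒜 k := h.internal.submodule_iSup_eq_top ▸ Submodule.mem_top
    induction ha using Submodule.iSup_induction' with
    | mem k a ha => exact Submodule.mem_iSup_of_mem k ⟨a • ι m, by rw [hp, hid _ _ ha]⟩
    | zero => simp
    | add a b _ _ ha hb => rw [add_smul]; exact add_mem ha hb
  have hint := isInternal_range p hpp hpp' htop
  refine ⟨D, _, _, _, ‹_›, ι, fun i => LinearMap.range (p (i - d)), hD, ⟨?_, ?_⟩, fun m => ?_⟩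
  · exact isInternal_range (fun i => p (i - d)) (fun i => hpp _)
      (fun i j hij => hpp' _ _ (by omega))
      (htop ▸ (Equiv.subRight d).iSup_congr fun _ => rfl)
  · rintro i j a _ ha ⟨x, rfl⟩
    exact ⟨a • x, by rw [add_sub_assoc, hpsmul ha]⟩
  · refine ⟨ι m, ?_⟩
    have := hp 0 1 m
    rwa [one_smul, hid _ _ h.one_mem, one_smul, ← sub_self d] at this

end ProperStandard

section SimpleHead

variable {K A}
variable {𝒜 : ℤ → Submodule K A} {Am T Ap : Subalgebra K A}

section Data

variable {d d' : ℤ} {M D M' D' : Type u} [AddCommGroup M] [Module ↥T M]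
  [AddCommGroup D] [Module A D] [Module K D] [IsScalarTower K A D]
  {ι : M →+ D} {ℳ : ℤ → Submodule K D} {rad : Submodule A D}
  [AddCommGroup M'] [Module ↥T M']
  [AddCommGroup D'] [Module A D'] [Module K D'] [IsScalarTower K A D']
  {ι' : M' →+ D'} {ℳ' : ℤ → Submodule K D'} {rad' : Submodule A D'}

lemma IsSimpleHeadData.exists_injective_linearMap (hD : IsSimpleHeadData K A 𝒜 T Ap d M D ι ℳ rad) :
    ∃ g : M →ₗ[↥T] D ⧸ rad, Function.Injective g ∧ ∀ m, g m = rad.mkQ (ι m) := by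
  obtain ⟨hM, hstd, -, -, hrad, -⟩ := hD
  let g : M →ₗ[↥T] D ⧸ rad :=
    { toFun := fun m => rad.mkQ (ι m)
      map_add' := fun m n => by simp
      map_smul' := fun t m => by rw [hstd.1, map_smul]; rfl }
  refine ⟨g, (LinearMap.injective_or_eq_zero g).resolve_right fun hg => hrad ?_, fun m => rfl⟩
  rw [eq_top_iff, ← hstd.span_eq_top, Submodule.span_le]
  rintro _ ⟨m, rfl⟩
  exact (Submodule.Quotient.mk_eq_zero rad).mp (LinearMap.congr_fun hg m)

lemma IsSimpleHeadData.degree_le (h : TriangularDecomposition K A 𝒜 Am T Ap)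
    (hD : IsSimpleHeadData K A 𝒜 T Ap d M D ι ℳ rad)
    (hD' : IsSimpleHeadData K A 𝒜 T Ap d' M' D' ι' ℳ' rad') (e : (D ⧸ rad) ≃ₗ[A] (D' ⧸ rad'))
    (he : e '' (rad.mkQ '' (ℳ d : Set D)) = rad'.mkQ '' (ℳ' d : Set D')) : d ≤ d' := by
  obtain ⟨g, hg, hgι⟩ := hD.exists_injective_linearMap
  obtain ⟨hM, -, -, hd, -⟩ := hD
  obtain ⟨-, hstd', hgr', hd', -⟩ := hD'
  have := IsSimpleModule.nontrivial ↥T M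
  obtain ⟨m, hm⟩ := exists_ne (0 : M)
  by_contra! hlt
  have hbot := (h.top_degree hgr' hstd'.1 hstd'.2.1 hstd'.span_eq_top hd').1 d hlt
  have hmem : e (rad.mkQ (ι m)) ∈ rad'.mkQ '' (ℳ' d : Set D') :=
    he ▸ ⟨_, ⟨_, hd m, rfl⟩, rfl⟩
  rw [hbot] at hmem
  obtain ⟨x, hx, hxe⟩ := hmem
  rw [(Submodule.mem_bot K).mp hx, map_zero, eq_comm, LinearEquiv.map_eq_zero_iff, ← hgι] at hxe
  exact hm (hg (hxe.trans (map_zero g).symm))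

lemma IsSimpleHeadData.nonempty_equiv (h : TriangularDecomposition K A 𝒜 Am T Ap)
    (hD : IsSimpleHeadData K A 𝒜 T Ap d M D ι ℳ rad)
    (hD' : IsSimpleHeadData K A 𝒜 T Ap d M' D' ι' ℳ' rad') (e : (D ⧸ rad) ≃ₗ[A] (D' ⧸ rad'))
    (he : e '' (rad.mkQ '' (ℳ d : Set D)) = rad'.mkQ '' (ℳ' d : Set D')) :
    Nonempty (M ≃ₗ[↥T] M') := by
  obtain ⟨g, hg, hgι⟩ := hD.exists_injective_linearMap
  obtain ⟨g', hg', hgι'⟩ := hD'.exists_injective_linearMap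
  obtain ⟨-, hstd, hgr, hd, -⟩ := hD
  obtain ⟨-, hstd', hgr', hd', -⟩ := hD'
  rw [(h.top_degree hgr hstd.1 hstd.2.1 hstd.span_eq_top hd).2,
    (h.top_degree hgr' hstd'.1 hstd'.2.1 hstd'.span_eq_top hd').2] at he
  let eT : (D ⧸ rad) →ₗ[↥T] (D' ⧸ rad') :=
    { toFun := e
      map_add' := e.map_add
      map_smul' := fun t x => e.map_smul (t : A) x }
  have hinj : Function.Injective (eT ∘ₗ g) := e.injective.comp hg
  have hrange : LinearMap.range (eT ∘ₗ g) = LinearMap.range g' := by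
    refine SetLike.coe_injective ?_
    rw [LinearMap.coe_range, LinearMap.coe_range, show ⇑g' = rad'.mkQ ∘ ι' from funext hgι',
      Set.range_comp, ← he, ← Set.range_comp, ← Set.range_comp]
    exact congrArg Set.range (funext fun m => congrArg e (hgι m))
  exact ⟨(LinearEquiv.ofInjective _ hinj).trans
    ((LinearEquiv.ofEq _ _ hrange).trans (LinearEquiv.ofInjective _ hg').symm)⟩

lemma IsSimpleHeadData.exists_head_equiv (hA : DirectSum.IsInternal 𝒜)
    (hD : IsSimpleHeadData K A 𝒜 T Ap d M D ι ℳ rad)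
    (hD' : IsSimpleHeadData K A 𝒜 T Ap d M' D' ι' ℳ' rad') (φ : M ≃ₗ[↥T] M') :
    ∃ e : (D ⧸ rad) ≃ₗ[A] (D' ⧸ rad'),
      ∀ i : ℤ, e '' (rad.mkQ '' (ℳ i : Set D)) = rad'.mkQ '' (ℳ' i : Set D') := by
  obtain ⟨-, hstd, hgr, hd, hne, hmax⟩ := hD
  obtain ⟨-, hstd', hgr', hd', hne', hmax'⟩ := hD'
  obtain ⟨E, hE⟩ := hstd.exists_equiv hstd' φ
  have hmap : rad.map E.toLinearMap = rad' := by
    refine le_antisymm (hmax' _ fun htop => hne ?_) ?_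
    · rw [← Submodule.comap_map_eq_of_injective (f := E.toLinearMap) E.injective rad, htop,
        Submodule.comap_top]
    · rw [← Submodule.map_comap_eq_of_surjective E.surjective rad']
      refine Submodule.map_mono (hmax _ fun htop => hne' ?_)
      rw [← Submodule.map_comap_eq_of_surjective (f := E.toLinearMap) E.surjective rad', htop,
        Submodule.map_top, LinearEquiv.range]
  refine ⟨Submodule.Quotient.equiv rad rad' E hmap, fun i => ?_⟩
  rw [← image_grading_eq hA hstd.span_eq_top hgr hd hgr' E.toLinearMap
    (fun m => by simpa [hE] using hd' _) E.surjective i, Set.image_image, Set.image_image]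
  rfl

end Data

section Surjectivity

variable {S : Type u} [AddCommGroup S] [Module A S] [Module K S] [IsScalarTower K A S]
  {𝒮 : ℤ → Submodule K S}

lemma IsGradedSimple.span_eq_top (hS : IsGradedSimple K A 𝒮) {X : Set S}
    (hX : ∀ x ∈ X, ∃ i, x ∈ 𝒮 i) {x : S} (hx : x ∈ X) (hx0 : x ≠ 0) :
    Submodule.span A X = ⊤ := by
  refine (hS.2 (Submodule.span A X) ?_).resolve_left fun hbot => hx0 ?_
  · refine Submodule.span_mono fun y hy => ?_
    obtain ⟨i, hi⟩ := hX y hy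
    exact Set.mem_iUnion.mpr ⟨i, Submodule.subset_span hy, hi⟩
  · exact Submodule.span_eq_bot.mp hbot x hx

/-- A nonzero homogeneous element of a graded simple module can be moved to any nonzero
homogeneous element by a homogeneous scalar. -/
lemma IsGradedSimple.exists_smul_eq (hA : DirectSum.IsInternal 𝒜)
    (hgr : IsModuleGrading K A 𝒜 𝒮) (hS : IsGradedSimple K A 𝒮) {i j : ℤ} {x y : S}
    (hx : x ∈ 𝒮 i) (hx0 : x ≠ 0) (hy : y ∈ 𝒮 j) : ∃ a ∈ 𝒜 (j - i), a • x = y := by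
  obtain ⟨ρ, hρmem, hρid, hρzero⟩ := exists_projections hA
  obtain ⟨π, -, hid, hzero⟩ := exists_projections hgr.1
  have htop := hS.span_eq_top (X := {x}) (by rintro _ rfl; exact ⟨i, hx⟩) rfl hx0
  obtain ⟨a, rfl⟩ := Submodule.mem_span_singleton.mp (htop ▸ Submodule.mem_top : y ∈ _)
  refine ⟨ρ (j - i) a, hρmem _ _, ?_⟩
  rw [← proj_smul_of_mem_right hA hgr hρid hρzero hid hzero hx, sub_add_cancel, hid _ _ hy]

lemma IsModuleGrading.exists_proj_ne_zero (hgr : IsModuleGrading K A 𝒜 𝒮)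
    {π : ℤ → S →ₗ[K] S} (hid : ∀ i, ∀ v ∈ 𝒮 i, π i v = v)
    (hzero : ∀ i j, i ≠ j → ∀ v ∈ 𝒮 j, π i v = 0) {x : S} (hx : x ≠ 0) : ∃ i, π i x ≠ 0 := by
  have hcomp : ∀ v i, π i (DirectSum.coeAddMonoidHom 𝒮 v) = v i := by
    intro v i
    induction v using DirectSum.induction_on with
    | zero => simp
    | of j s =>
      rw [DirectSum.coeAddMonoidHom_of, DirectSum.coe_of_apply]
      split_ifs with hji
      · subst hji
        exact hid _ _ s.2
      · exact hzero _ _ (Ne.symm hji) _ s.2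
    | add v w hv hw => rw [map_add, map_add, hv, hw]; rfl
  by_contra! hall
  obtain ⟨v, rfl⟩ := hgr.1.2 x
  refine hx ?_
  have hv : v = 0 := by
    ext i
    rw [← hcomp, hall]
    rfl
  rw [hv, map_zero]

lemma IsGradedSimple.exists_top_degree [FiniteDimensional K A]
    (hA : DirectSum.IsInternal 𝒜) (hgr : IsModuleGrading K A 𝒜 𝒮)
    (hS : IsGradedSimple K A 𝒮) : ∃ d, 𝒮 d ≠ ⊥ ∧ ∀ i, d < i → 𝒮 i = ⊥ := by
  have := hS.1
  obtain ⟨B, hB⟩ := exists_bound hA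
  obtain ⟨i, hi⟩ : ∃ i, 𝒮 i ≠ ⊥ := by
    by_contra! hall
    have := hgr.1.submodule_iSup_eq_top
    rw [iSup_eq_bot.mpr hall] at this
    obtain ⟨x, hx⟩ := exists_ne (0 : S)
    exact hx ((Submodule.mem_bot K).mp (this ▸ Submodule.mem_top))
  obtain ⟨x, hx, hx0⟩ := (𝒮 i).ne_bot_iff.mp hi
  have hbdd : ∀ j, 𝒮 j ≠ ⊥ → j ≤ i + B := by
    intro j hj
    by_contra! hlt
    obtain ⟨y, hy, hy0⟩ := (𝒮 j).ne_bot_iff.mp hj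
    obtain ⟨a, ha, rfl⟩ := hS.exists_smul_eq hA hgr hx hx0 hy
    rw [hB (j - i) (lt_of_lt_of_le (by omega) (le_abs_self _)), Submodule.mem_bot] at ha
    exact hy0 (by rw [ha, zero_smul])
  obtain ⟨d, hd, hmax⟩ := Int.exists_greatest_of_bdd ⟨i + B, hbdd⟩ ⟨i, hi⟩
  exact ⟨d, hd, fun j hj => by_contra fun hne => absurd (hmax j hne) (not_le.mpr hj)⟩

/-- The degree `d` part of a graded `A`-module as a `T`-submodule. -/
def degreePart (hT : T.toSubmodule ≤ 𝒜 0) (hgr : IsModuleGrading K A 𝒜 𝒮) (d : ℤ) :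
    Submodule ↥T S where
  carrier := 𝒮 d
  add_mem' := add_mem
  zero_mem' := zero_mem _
  smul_mem' t x hx := by
    have := hgr.2 0 d t x (hT t.2) hx
    rwa [zero_add] at this

lemma smul_eq_zero_of_mem_Jpos (hgr : IsModuleGrading K A 𝒜 𝒮) {d : ℤ}
    (htop : ∀ i, d < i → 𝒮 i = ⊥) {a : A} (ha : a ∈ Jpos K A 𝒜 T Ap) {x : S} (hx : x ∈ 𝒮 d) :
    a • x = 0 := by
  have hle : Jpos K A 𝒜 T Ap ≤
      LinearMap.ker ((LinearMap.toSpanSingleton A _ x).restrictScalars K) := by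
    refine iSup₂_le fun i hi b hb => ?_
    have := hgr.2 i d b x hb.2 hx
    rw [htop _ (by omega)] at this
    exact (Submodule.mem_bot K).mp this
  exact hle ha

/-- The top degree part of a graded simple `A`-module is a simple `T`-module. -/
lemma IsGradedSimple.isSimpleModule_degreePart (h : TriangularDecomposition K A 𝒜 Am T Ap)
    (hgr : IsModuleGrading K A 𝒜 𝒮) (hS : IsGradedSimple K A 𝒮) {d : ℤ} (hne : 𝒮 d ≠ ⊥)
    (htop : ∀ i, d < i → 𝒮 i = ⊥) : IsSimpleModule ↥T (degreePart h.T_deg0 hgr d) := by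
  rw [isSimpleModule_iff_isAtom]
  obtain ⟨x, hx, hx0⟩ := (𝒮 d).ne_bot_iff.mp hne
  refine ⟨(Submodule.ne_bot_iff _).mpr ⟨x, hx, hx0⟩, fun N hN => ?_⟩
  by_contra hN0
  obtain ⟨y, hy, hy0⟩ := N.ne_bot_iff.mp hN0
  have hmem : ∀ n ∈ N, n ∈ 𝒮 d := hN.le
  have hrange : Set.range N.subtype.toAddMonoidHom = N := Subtype.range_coe
  have hgen : Submodule.span A (Set.range N.subtype.toAddMonoidHom) = ⊤ :=
    hS.span_eq_top (by rw [hrange]; exact fun n hn => ⟨d, hmem n hn⟩) (hrange ▸ hy) hy0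
  have := (h.top_degree hgr (f := N.subtype.toAddMonoidHom) (fun t m => rfl)
    (fun a ha m => smul_eq_zero_of_mem_Jpos hgr htop ha (hmem m m.2)) hgen
    (fun m => hmem m m.2)).2
  rw [hrange] at this
  exact hN.not_ge this.le

lemma IsGradedSimple.exists_simpleHead [FiniteDimensional K A]
    (h : TriangularDecomposition K A 𝒜 Am T Ap)
    (hgr : IsModuleGrading K A 𝒜 𝒮) (hS : IsGradedSimple K A 𝒮) :
    ∃ (d : ℤ) (M : Type u) (_ : AddCommGroup M) (_ : Module ↥T M)
      (D : Type u) (_ : AddCommGroup D) (_ : Module A D) (_ : Module K D)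
      (_ : IsScalarTower K A D) (ι : M →+ D) (ℳ : ℤ → Submodule K D) (rad : Submodule A D),
      IsSimpleHeadData K A 𝒜 T Ap d M D ι ℳ rad ∧
        ∃ e : (D ⧸ rad) ≃ₗ[A] S,
          ∀ i : ℤ, e '' (rad.mkQ '' (ℳ i : Set D)) = (𝒮 i : Set S) := by
  obtain ⟨d, hne, htop⟩ := hS.exists_top_degree h.internal hgr
  obtain ⟨w, hw, hw0⟩ := (𝒮 d).ne_bot_iff.mp hne
  have hsimple := hS.isSimpleModule_degreePart h hgr hne htop
  let M := degreePart h.T_deg0 hgr d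
  obtain ⟨D, _, _, _, _, ι, ℳ, hstd, hℳ, hd⟩ := h.exists_graded_properStandard d M
  obtain ⟨G, hG, -⟩ := hstd.2.2 S M.subtype.toAddMonoidHom (fun t m => rfl)
    fun a ha m => smul_eq_zero_of_mem_Jpos hgr htop ha m.2
  have hGmem : ∀ m, G (ι m) ∈ 𝒮 d := fun m => by rw [hG]; exact m.2
  have hwG : w ∈ LinearMap.range G := ⟨ι ⟨w, hw⟩, hG _⟩
  have hsurj : Function.Surjective G := by
    rw [← LinearMap.range_eq_top, eq_top_iff,
      ← hS.span_eq_top (X := {w}) (by rintro _ rfl; exact ⟨d, hw⟩) rfl hw0]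
    exact Submodule.span_le.mpr (Set.singleton_subset_iff.mpr hwG)
  refine ⟨d, M, inferInstance, inferInstance, D, _, _, _, ‹_›, ι, ℳ, LinearMap.ker G,
    ⟨hsimple, hstd, hℳ, hd, fun hker => hw0 ?_, fun N hN => ?_⟩,
    G.quotKerEquivOfSurjective hsurj, fun i => ?_⟩
  · obtain ⟨x, rfl⟩ := hwG
    exact (hker ▸ Submodule.mem_top : x ∈ LinearMap.ker G)
  · by_contra hNker
    obtain ⟨x, hxN, hx⟩ := SetLike.not_le_iff_exists.mp hNker
    obtain ⟨π, hπmem, hid, hzero⟩ := exists_projections hgr.1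
    obtain ⟨i, hi⟩ := hgr.exists_proj_ne_zero hid hzero hx
    obtain ⟨a, ha, haw⟩ := hS.exists_smul_eq h.internal hgr (hπmem i _) hi hw
    obtain ⟨m, z, hz, hmz⟩ := h.range_sup_lowerPart hstd.1 hstd.2.1 (x := a • x)
      (hstd.span_eq_top ▸ Submodule.mem_top)
    have hm : m ≠ 0 := by
      rintro rfl
      have hz0 := proj_eq_zero_of_mem_lowerPart hgr hzero
        (f := G.toAddMonoidHom.comp ι) hGmem le_rfl (map_mem_lowerPart G hz)
      rw [map_zero, zero_add] at hmz
      have hax := proj_smul_of_mem_left hgr hid hzero ha i (G x)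
      rw [sub_add_cancel, haw, ← map_smul, ← hmz, hz0] at hax
      exact hw0 hax.symm
    refine hN (eq_top_of_forall_add_mem h.internal h.one_mem h.mul_mem hstd.span_eq_top N
      fun m' => ?_)
    obtain ⟨t, rfl⟩ := IsSimpleModule.toSpanSingleton_surjective ↥T hm m'
    refine ⟨(t : A) • z, smul_mem_lowerPart h.mul_mem (h.T_deg0 t.2) hz, ?_⟩
    rw [LinearMap.toSpanSingleton_apply, hstd.1, ← smul_add, hmz]
    exact N.smul_mem _ (N.smul_mem _ hxN)
  · rw [Set.image_image, ← image_grading_eq h.internal hstd.span_eq_top hℳ hd hgr G hGmem hsurj i]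
    rfl

end Surjectivity

end SimpleHead

/-- The assignment `λ ↦ L(λ) = Hd(Δ̄(λ))` is a bijection from
isomorphism classes of simple graded `T`-modules to isomorphism classes of simple
graded `A`-modules: two simple heads are isomorphic as graded `A`-modules exactly
when the underlying simple graded `T`-modules are isomorphic, and every simple
graded `A`-module arises as such a head. -/
theorem simple_head_bijection (𝒜 : ℤ → Submodule K A) (Am T Ap : Subalgebra K A)
    [FiniteDimensional K A] (h : TriangularDecomposition K A 𝒜 Am T Ap) :
    -- `L` is injective and well defined on isomorphism classes:
    (∀ (d₁ : ℤ) (M₁ : Type u) (_ : AddCommGroup M₁) (_ : Module ↥T M₁)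
       (D₁ : Type u) (_ : AddCommGroup D₁) (_ : Module A D₁) (_ : Module K D₁)
       (_ : IsScalarTower K A D₁) (ι₁ : M₁ →+ D₁) (ℳ₁ : ℤ → Submodule K D₁)
       (rad₁ : Submodule A D₁)
       (_ : IsSimpleHeadData K A 𝒜 T Ap d₁ M₁ D₁ ι₁ ℳ₁ rad₁)
       (d₂ : ℤ) (M₂ : Type u) (_ : AddCommGroup M₂) (_ : Module ↥T M₂)
       (D₂ : Type u) (_ : AddCommGroup D₂) (_ : Module A D₂) (_ : Module K D₂)
       (_ : IsScalarTower K A D₂) (ι₂ : M₂ →+ D₂) (ℳ₂ : ℤ → Submodule K D₂)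
       (rad₂ : Submodule A D₂)
       (_ : IsSimpleHeadData K A 𝒜 T Ap d₂ M₂ D₂ ι₂ ℳ₂ rad₂),
       ((∃ e : (D₁ ⧸ rad₁) ≃ₗ[A] (D₂ ⧸ rad₂),
            ∀ i : ℤ, e '' (rad₁.mkQ '' (ℳ₁ i : Set D₁)) = rad₂.mkQ '' (ℳ₂ i : Set D₂)) ↔
        (d₁ = d₂ ∧ Nonempty (M₁ ≃ₗ[↥T] M₂)))) ∧
    -- `L` is surjective onto isomorphism classes of simple graded `A`-modules:
    (∀ (S : Type u) (_ : AddCommGroup S) (_ : Module A S) (_ : Module K S)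
       (_ : IsScalarTower K A S) (𝒮 : ℤ → Submodule K S),
       IsModuleGrading K A 𝒜 𝒮 → IsGradedSimple K A 𝒮 →
       ∃ (d : ℤ) (M : Type u) (_ : AddCommGroup M) (_ : Module ↥T M)
         (D : Type u) (_ : AddCommGroup D) (_ : Module A D) (_ : Module K D)
         (_ : IsScalarTower K A D) (ι : M →+ D) (ℳ : ℤ → Submodule K D)
         (rad : Submodule A D),
         IsSimpleHeadData K A 𝒜 T Ap d M D ι ℳ rad ∧
         ∃ e : (D ⧸ rad) ≃ₗ[A] S,
           ∀ i : ℤ, e '' (rad.mkQ '' (ℳ i : Set D)) = (𝒮 i : Set S)) := by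
  refine ⟨?_, fun S _ _ _ _ 𝒮 hgr hS => hS.exists_simpleHead h hgr⟩
  intro d₁ M₁ _ _ D₁ _ _ _ _ ι₁ ℳ₁ rad₁ h₁ d₂ M₂ _ _ D₂ _ _ _ _ ι₂ ℳ₂ rad₂ h₂
  constructor
  · rintro ⟨e, he⟩
    have hd : d₁ = d₂ := by
      refine le_antisymm (h₁.degree_le h h₂ e (he d₁)) (h₂.degree_le h h₁ e.symm ?_)
      rw [← he, Set.image_image]
      simp
    subst hd
    exact ⟨rfl, h₁.nonempty_equiv h h₂ e (he d₁)⟩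
  · rintro ⟨rfl, ⟨φ⟩⟩
    exact h₁.exists_head_equiv h.internal h₂ φ

end TriangularPaper
end

section
/- Let A be a finite-dimensional Z-graded K-algebra with triangular decomposition (A⁻,T,A⁺). The restriction map χ : K₀(G(A)) → K₀(G(T)) between the Grothendieck groups of the categories of finitely generated graded modules, viewed as Z[t,t⁻¹]-module morphism where t acts by grading shift, is injective. -/
open scoped TensorProduct

universe u

namespace TriangularPaper

variable (K A : Type u) [Field K] [Ring A] [Algebra K A]

/-- Two `R`-modules have the same class in the Grothendieck group `K₀`:
they admit finite filtrations with isomorphic factors up to permutation. -/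
def MatchingFactors (R : Type u) [Ring R] (X Y : Type u) [AddCommGroup X] [Module R X]
    [AddCommGroup Y] [Module R Y] : Prop :=
  ∃ (n : ℕ) (F : Fin (n + 1) → Submodule R X) (G : Fin (n + 1) → Submodule R Y)
    (σ : Equiv.Perm (Fin n)),
    Monotone F ∧ Monotone G ∧ F 0 = ⊥ ∧ F (Fin.last n) = ⊤ ∧ G 0 = ⊥ ∧ G (Fin.last n) = ⊤ ∧
    ∀ k : Fin n, Nonempty
      ((↥(F k.succ) ⧸ Submodule.comap (F k.succ).subtype (F k.castSucc)) ≃ₗ[R]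
       (↥(G (σ k).succ) ⧸ Submodule.comap (G (σ k).succ).subtype (G (σ k).castSucc)))

/-- The induced degree-`i` piece on the subquotient `Q/P` of a graded module. -/
noncomputable def factorPiece {M : Type u} [AddCommGroup M] [Module A M] [Module K M]
    [IsScalarTower K A M] (ℳ : ℤ → Submodule K M) (P Q : Submodule A M) (i : ℤ) :
    Set (↥Q ⧸ Submodule.comap Q.subtype P) :=
  (Submodule.comap Q.subtype P).mkQ '' {x : ↥Q | (x : M) ∈ ℳ i}

/-- Two graded `A`-modules have the same class in the Grothendieck group `K₀(𝒢(A))`: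
they admit finite filtrations by graded submodules whose factors are isomorphic as
graded `A`-modules, up to permutation. -/
def GradedMatchingFactors {M N : Type u} [AddCommGroup M] [Module A M] [Module K M]
    [IsScalarTower K A M] [AddCommGroup N] [Module A N] [Module K N] [IsScalarTower K A N]
    (ℳ : ℤ → Submodule K M) (𝒩 : ℤ → Submodule K N) : Prop :=
  ∃ (n : ℕ) (F : Fin (n + 1) → Submodule A M) (G : Fin (n + 1) → Submodule A N)
    (σ : Equiv.Perm (Fin n)),
    Monotone F ∧ Monotone G ∧ F 0 = ⊥ ∧ F (Fin.last n) = ⊤ ∧ G 0 = ⊥ ∧ G (Fin.last n) = ⊤ ∧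
    ∀ k : Fin n, ∃ e :
        (↥(F k.succ) ⧸ Submodule.comap (F k.succ).subtype (F k.castSucc)) ≃ₗ[A]
        (↥(G (σ k).succ) ⧸ Submodule.comap (G (σ k).succ).subtype (G (σ k).castSucc)),
      ∀ i : ℤ, e '' factorPiece K A ℳ (F k.castSucc) (F k.succ) i =
        factorPiece K A 𝒩 (G (σ k).castSucc) (G (σ k).succ) i

end TriangularPaper

namespace TriangularPaper

theorem exists_idempotent_detecting_simple {R : Type u} [Ring R] [IsArtinianRing R]
    (V : Type u) [AddCommGroup V] [Module R V] [IsSimpleModule R V] :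
    ∃ e : R, IsIdempotentElem e ∧ (∃ v : V, e • v ≠ 0) ∧
      ∀ (W : Type u) [AddCommGroup W] [Module R W], IsSimpleModule R W →
        (∃ w : W, e • w ≠ 0) → Nonempty (V ≃ₗ[R] W) := by
  let J := Ring.jacobson R
  let S := R ⧸ J
  let q : R →ₗ[R] S := J.mkQ
  have hss : IsSemisimpleModule R S := by
    have : IsSemisimpleRing S := IsSemiprimaryRing.isSemisimpleRing
    let f : S →ₛₗ[Ideal.Quotient.mk J] S :=
      { toFun := id
        map_add' := fun _ _ => rfl
        map_smul' := fun r x => by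
          induction x using Submodule.Quotient.induction_on
          rfl }
    exact (LinearMap.isSemisimpleModule_iff_of_bijective f Function.bijective_id).2 inferInstance
  have act : ∀ (W : Type u) [AddCommGroup W] [Module R W], IsSimpleModule R W → ∀ w : W,
      ∃ ψ : S →ₗ[R] W, ∀ r, ψ (q r) = r • w := by
    intro W _ _ hW w
    refine ⟨J.liftQ (LinearMap.toSpanSingleton R W w) fun r hr => ?_, fun r => ?_⟩
    · have := IsSemisimpleModule.jacobson_le_annihilator R W hr
      simpa using Module.mem_annihilator.1 this w
    · exact (Submodule.liftQ_apply _ _ _).trans (LinearMap.toSpanSingleton_apply R W w r)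
  let I := isotypicComponent R S V
  obtain ⟨C, hC⟩ := exists_isCompl I
  obtain ⟨x, hx, c, hc, hxc⟩ := Submodule.mem_sup.1
    (hC.sup_eq_top ▸ Submodule.mem_top : q 1 ∈ I ⊔ C)
  have hmul : ∀ r : R, q r ∈ I → r • x = q r := by
    intro r hr
    have h1 : r • x + r • c = q r := by rw [← smul_add, hxc, ← map_smul]; simp
    have h2 : r • c ∈ I := by
      rw [← eq_sub_iff_add_eq'] at h1
      rw [h1]; exact I.sub_mem hr (I.smul_mem _ hx)
    have h3 : r • c = 0 := (Submodule.disjoint_def.1 hC.disjoint) _ h2 (C.smul_mem _ hc)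
    rw [← h1, h3, add_zero]
  obtain ⟨e, he, hex⟩ : ∃ e : R, IsIdempotentElem e ∧ q e = x := by
    obtain ⟨r, rfl⟩ := J.mkQ_surjective x
    refine exists_isIdempotentElem_eq_of_ker_isNilpotent (Ideal.Quotient.mk J) ?_
      (Ideal.Quotient.mk J r) ⟨r, rfl⟩ (hmul r hx)
    intro y hy
    obtain ⟨n, hn⟩ := IsSemiprimaryRing.isNilpotent (R := R)
    rw [Ideal.mk_ker] at hy
    have hyn : y ^ n ∈ J ^ n := Ideal.pow_mem_pow hy n
    rw [show J ^ n = ⊥ from hn] at hyn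
    exact ⟨n, hyn⟩
  refine ⟨e, he, ?_, ?_⟩
  · by_contra! hV
    have hle : ∀ y ∈ I, e • y = 0 := by
      let N : Submodule R S :=
        { carrier := {y | ∀ r : R, e • r • y = 0}
          add_mem' := fun ha hb r => by rw [smul_add, smul_add, ha, hb, add_zero]
          zero_mem' := fun r => by simp
          smul_mem' := fun s y hy r => by rw [← mul_smul r s]; exact hy _ }
      have : I ≤ N := by
        refine sSup_le ?_
        rintro m ⟨f⟩ y hy r
        have : e • r • (⟨y, hy⟩ : m) = 0 := by
          apply f.injective; rw [map_smul, hV, map_zero]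
        exact congrArg Subtype.val this
      intro y hy
      simpa using this hy 1
    have hx0 : x = 0 := by rw [← hex, ← hmul e (hex ▸ hx), hle x hx]
    have hI : I = ⊥ := by
      rw [eq_bot_iff]
      intro y hy
      obtain ⟨r, rfl⟩ := J.mkQ_surjective y
      rw [Submodule.mem_bot, ← show r • x = _ from hmul r hy, hx0, smul_zero]
    have := IsSimpleModule.nontrivial R V
    obtain ⟨v, hv⟩ := exists_ne (0 : V)
    obtain ⟨ψ, hψ⟩ := act V inferInstance v
    have hψ0 : ψ ≠ 0 := by
      rintro rfl
      exact hv (by simpa using (hψ 1).symm)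
    have hs := ψ.surjective_of_ne_zero hψ0
    obtain ⟨m, hm⟩ := exists_isCompl (LinearMap.ker ψ)
    have f : m ≃ₗ[R] V := (Submodule.quotientEquivOfIsCompl _ _ hm).symm.trans
      (ψ.quotKerEquivOfSurjective hs)
    have hmI : m ≤ I := le_sSup ⟨f⟩
    rw [hI, le_bot_iff] at hmI
    apply hv
    rw [← f.apply_symm_apply v]
    have : f.symm v = 0 := Subtype.ext (by simpa [hmI] using (f.symm v).2)
    rw [this, map_zero]
  · rintro W _ _ hW ⟨w, hw⟩
    obtain ⟨ψ, hψ⟩ := act W hW w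
    by_contra hno
    apply hw
    rw [← hψ, hex]
    have : I ≤ LinearMap.ker ψ := by
      refine sSup_le ?_
      rintro m ⟨f⟩ y hy
      have : IsSimpleModule R m := IsSimpleModule.congr f
      have h0 : ψ.comp m.subtype = 0 := by
        by_contra h0
        exact hno ⟨f.symm.trans (LinearEquiv.ofBijective _ (LinearMap.bijective_of_ne_zero h0))⟩
      exact LinearMap.congr_fun h0 ⟨y, hy⟩
    exact this hx

section Weights

variable (K : Type u) [Field K] {R : Type u} [Ring R] [Algebra K R]

/-- The `K`-dimension of `e • W`. -/
noncomputable def smulRank {X : Type u} [AddCommGroup X] [Module R X] [Module K X]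
    [IsScalarTower K R X] (e : R) (W : Submodule K X) : ℕ :=
  Module.finrank K (W.map (Algebra.lsmul K K X e))

variable {K}

theorem finrank_map_idempotent {V V' : Type u} [AddCommGroup V] [Module K V] [AddCommGroup V']
    [Module K V'] [FiniteDimensional K V] (π : V →ₗ[K] V) (hπ : ∀ x, π (π x) = π x)
    (π' : V' →ₗ[K] V') (q : V →ₗ[K] V') (hq : ∀ x, q (π x) = π' (q x)) (W : Submodule K V)
    (hW : ∀ x ∈ W, π x ∈ W) :
    Module.finrank K (W.map π) =
      Module.finrank K ((W.map q).map π') + Module.finrank K ↥((W ⊓ LinearMap.ker q).map π) := by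
  have h := LinearMap.finrank_range_add_finrank_ker (q.domRestrict (W.map π))
  have h1 : LinearMap.range (q.domRestrict (W.map π)) = (W.map q).map π' := by
    rw [LinearMap.range_domRestrict, ← Submodule.map_comp, ← Submodule.map_comp]
    congr 1
    ext x
    exact hq x
  have h2 : (LinearMap.ker (q.domRestrict (W.map π))).map (W.map π).subtype =
      (W ⊓ LinearMap.ker q).map π := by
    ext x
    simp only [Submodule.mem_map, LinearMap.mem_ker, Submodule.mem_inf]
    constructor
    · rintro ⟨⟨_, w, hw, rfl⟩, hy, rfl⟩
      exact ⟨π w, ⟨hW w hw, hy⟩, hπ w⟩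
    · rintro ⟨w, ⟨hw, hqw⟩, rfl⟩
      refine ⟨⟨π w, w, hw, rfl⟩, ?_, rfl⟩
      change q (π w) = 0
      rw [hq, hqw, map_zero]
  rw [← h, h1, ← h2, Submodule.finrank_map_subtype_eq]

variable {X : Type u} [AddCommGroup X] [Module R X] [Module K X] [IsScalarTower K R X]

/-- The image of a `K`-subspace `W` in the subquotient `Q / P`. -/
noncomputable def subquotientImage (P Q : Submodule R X) (W : Submodule K X) :
    Submodule K (↥Q ⧸ Submodule.comap Q.subtype P) :=
  (W.comap (Q.subtype.restrictScalars K)).map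
    ((Submodule.comap Q.subtype P).mkQ.restrictScalars K)

theorem smulRank_map_of_injective {Y : Type u} [AddCommGroup Y] [Module R Y] [Module K Y]
    [IsScalarTower K R Y] (e : R) (f : X →ₗ[R] Y) (hf : Function.Injective f)
    (W : Submodule K X) : smulRank K e (W.map (f.restrictScalars K)) = smulRank K e W := by
  have : (W.map (f.restrictScalars K)).map (Algebra.lsmul K K Y e) =
      (W.map (Algebra.lsmul K K X e)).map (f.restrictScalars K) := by
    rw [← Submodule.map_comp, ← Submodule.map_comp]
    congr 1
    ext x
    exact (map_smul f e x).symm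
  rw [smulRank, this]
  exact (LinearEquiv.finrank_eq (Submodule.equivMapOfInjective (f.restrictScalars K) hf _)).symm

theorem smulRank_inf_eq_add [FiniteDimensional K X] {e : R} (he : IsIdempotentElem e)
    {P Q : Submodule R X} (hPQ : P ≤ Q) (W : Submodule K X) (hW : ∀ x ∈ W, e • x ∈ W) :
    smulRank K e (W ⊓ Q.restrictScalars K) =
      smulRank K e (subquotientImage P Q W) + smulRank K e (W ⊓ P.restrictScalars K) := by
  have : FiniteDimensional K Q :=
    FiniteDimensional.of_injective (Q.subtype.restrictScalars K) Subtype.val_injective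
  have h := finrank_map_idempotent (Algebra.lsmul K K Q e)
    (fun x => by simp [Algebra.lsmul_apply, ← mul_smul, he.eq]) (Algebra.lsmul K K _ e)
    ((Submodule.comap Q.subtype P).mkQ.restrictScalars K) (fun x => map_smul (Submodule.comap Q.subtype P).mkQ e x)
    (W.comap (Q.subtype.restrictScalars K)) (fun x hx => hW _ hx)
  have h1 := smulRank_map_of_injective e Q.subtype Subtype.val_injective
    (W.comap (Q.subtype.restrictScalars K))
  have h2 := smulRank_map_of_injective e Q.subtype Subtype.val_injective
    (W.comap (Q.subtype.restrictScalars K) ⊓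
      LinearMap.ker ((Submodule.comap Q.subtype P).mkQ.restrictScalars K))
  have e1 : (W.comap (Q.subtype.restrictScalars K)).map (Q.subtype.restrictScalars K) =
      W ⊓ Q.restrictScalars K := by
    ext x
    constructor
    · rintro ⟨y, hy, rfl⟩
      exact ⟨hy, y.2⟩
    · rintro ⟨hx, hxQ⟩
      exact ⟨⟨x, hxQ⟩, hx, rfl⟩
  have e2 : (W.comap (Q.subtype.restrictScalars K) ⊓
      LinearMap.ker ((Submodule.comap Q.subtype P).mkQ.restrictScalars K)).map
        (Q.subtype.restrictScalars K) = W ⊓ P.restrictScalars K := by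
    ext x
    constructor
    · rintro ⟨y, ⟨hy, hyP⟩, rfl⟩
      exact ⟨hy, (Submodule.Quotient.mk_eq_zero (Submodule.comap Q.subtype P)).1 hyP⟩
    · rintro ⟨hx, hxP⟩
      exact ⟨⟨x, hPQ hxP⟩, ⟨hx, (Submodule.Quotient.mk_eq_zero (Submodule.comap Q.subtype P)).2 hxP⟩, rfl⟩
  rw [e1] at h1
  rw [e2] at h2
  rw [h1, h2]
  exact h

theorem Fin.last_eq_sum_add {n : ℕ} (f : Fin (n + 1) → ℕ) (g : Fin n → ℕ)
    (h : ∀ k, f k.succ = g k + f k.castSucc) : f (Fin.last n) = ∑ k, g k + f 0 := by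
  induction n with
  | zero => simp
  | succ n ih =>
    have := ih (fun k => f k.castSucc) (fun k => g k.castSucc) fun k => by
      simpa using h k.castSucc
    rw [Fin.sum_univ_castSucc, ← Fin.succ_last, h, this]
    simp only [Fin.castSucc_zero]
    ring

theorem smulRank_eq_sum [FiniteDimensional K X] {e : R} (he : IsIdempotentElem e)
    (W : Submodule K X) (hW : ∀ x ∈ W, e • x ∈ W) {n : ℕ} (F : Fin (n + 1) → Submodule R X)
    (hF : Monotone F) (h0 : F 0 = ⊥) (h1 : F (Fin.last n) = ⊤) :
    smulRank K e W =
      ∑ k : Fin n, smulRank K e (subquotientImage (F k.castSucc) (F k.succ) W) := by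
  have h := Fin.last_eq_sum_add (fun k => smulRank K e (W ⊓ (F k).restrictScalars K)) _
    fun k => smulRank_inf_eq_add he (hF (Fin.castSucc_le_succ k)) W hW
  simp only [h0, h1, Submodule.restrictScalars_top, Submodule.restrictScalars_bot, inf_top_eq,
    inf_bot_eq] at h
  rwa [show smulRank K e (⊥ : Submodule K X) = 0 by rw [smulRank, Submodule.map_bot, finrank_bot],
    add_zero] at h

theorem subquotientImage_top (P Q : Submodule R X) :
    subquotientImage P Q (⊤ : Submodule K X) = ⊤ := by
  rw [subquotientImage, Submodule.comap_top, Submodule.map_top, LinearMap.range_eq_top]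
  exact Submodule.mkQ_surjective (Submodule.comap Q.subtype P)

theorem smulRank_top_congr {Y : Type u} [AddCommGroup Y] [Module R Y] [Module K Y]
    [IsScalarTower K R Y] (e : R) (f : X ≃ₗ[R] Y) :
    smulRank K e (⊤ : Submodule K X) = smulRank K e (⊤ : Submodule K Y) := by
  rw [← smulRank_map_of_injective e f.toLinearMap f.injective, Submodule.map_top,
    LinearMap.range_eq_top.2]
  exact f.surjective

theorem MatchingFactors.smulRank_eq {Y : Type u} [AddCommGroup Y] [Module R Y] [Module K Y]
    [IsScalarTower K R Y] [FiniteDimensional K X] [FiniteDimensional K Y]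
    (h : MatchingFactors R X Y) {e : R} (he : IsIdempotentElem e) :
    smulRank K e (⊤ : Submodule K X) = smulRank K e (⊤ : Submodule K Y) := by
  obtain ⟨n, F, G, σ, hF, hG, hF0, hF1, hG0, hG1, hσ⟩ := h
  rw [smulRank_eq_sum he ⊤ (fun _ _ => trivial) F hF hF0 hF1,
    smulRank_eq_sum he ⊤ (fun _ _ => trivial) G hG hG0 hG1]
  refine Eq.trans ?_ (Equiv.sum_comp σ _)
  refine Finset.sum_congr rfl fun k _ => ?_
  obtain ⟨f⟩ := hσ k
  rw [subquotientImage_top, subquotientImage_top]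
  exact smulRank_top_congr e f

end Weights

section Matching

variable {Λ : Type u}

/-- Two finite families of `ℕ`-valued characters, unitriangular with respect to the degree and
having the same sum, can be matched. -/
theorem exists_equiv_of_sum_eq (m : ℕ) {α β : Type} [Fintype α] [Fintype β]
    (hm : Fintype.card α = m) (d : α → ℤ)
    (d' : β → ℤ) (g : Λ → ℤ → α → ℕ) (g' : Λ → ℤ → β → ℕ) (r : α → β → Prop)
    (hα : ∀ a, ∃ l, g l (d a) a ≠ 0 ∧ ∀ b, d' b ≤ d a → g' l (d a) b ≠ 0 → r a b)
    (hβ : ∀ b, ∃ l, g' l (d' b) b ≠ 0 ∧ ∀ a, d a ≤ d' b → g l (d' b) a ≠ 0 → r a b)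
    (hr : ∀ a b, r a b → ∀ l i, g l i a = g' l i b)
    (h : ∀ l i, ∑ a, g l i a = ∑ b, g' l i b) :
    ∃ σ : α ≃ β, ∀ a, r a (σ a) := by
  classical
  by_cases hne : Nonempty (α ⊕ β)
  · obtain ⟨a, b, hab⟩ : ∃ a b, r a b := by
      obtain ⟨x, hx⟩ := Finite.exists_max (Sum.elim d d')
      cases x with
      | inl a =>
        obtain ⟨l, hl, hl'⟩ := hα a
        have hpos : ∑ b, g' l (d a) b ≠ 0 := by
          rw [← h]
          exact fun h0 => hl (Finset.sum_eq_zero_iff.1 h0 a (Finset.mem_univ _))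
        obtain ⟨b, -, hb⟩ := Finset.exists_ne_zero_of_sum_ne_zero hpos
        exact ⟨a, b, hl' b (hx (Sum.inr b)) hb⟩
      | inr b =>
        obtain ⟨l, hl, hl'⟩ := hβ b
        have hpos : ∑ a, g l (d' b) a ≠ 0 := by
          rw [h]
          exact fun h0 => hl (Finset.sum_eq_zero_iff.1 h0 b (Finset.mem_univ _))
        obtain ⟨a, -, ha⟩ := Finset.exists_ne_zero_of_sum_ne_zero hpos
        exact ⟨a, b, hl' a (hx (Sum.inl a)) ha⟩
    have hcard : Fintype.card {x // x ≠ a} < m := by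
      rw [← hm]
      exact Fintype.card_subtype_lt (x := a) (by simp)
    obtain ⟨σ, hσ⟩ := exists_equiv_of_sum_eq (Fintype.card {x // x ≠ a}) (α := {x // x ≠ a})
      (β := {y // y ≠ b}) rfl (fun x => d x) (fun y => d' y) (fun l i x => g l i x)
      (fun l i y => g' l i y) (fun x y => r x y)
      (fun x => by
        obtain ⟨l, hl, hl'⟩ := hα x
        exact ⟨l, hl, fun y => hl' y⟩)
      (fun y => by
        obtain ⟨l, hl, hl'⟩ := hβ y
        exact ⟨l, hl, fun x => hl' x⟩)
      (fun x y => hr x y)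
      (fun l i => by
        have := h l i
        rw [Fintype.sum_eq_add_sum_subtype_ne _ a, Fintype.sum_eq_add_sum_subtype_ne _ b,
          hr a b hab] at this
        exact Nat.add_left_cancel this)
    refine ⟨(Equiv.optionSubtypeNe a).symm.trans
      ((Equiv.optionCongr σ).trans (Equiv.optionSubtypeNe b)), fun x => ?_⟩
    obtain ⟨o, rfl⟩ := (Equiv.optionSubtypeNe a).surjective x
    cases o with
    | none => simpa using hab
    | some x => simpa [x.2] using hσ x
  · have hα' : IsEmpty α := ⟨fun a => hne ⟨Sum.inl a⟩⟩
    have hβ' : IsEmpty β := ⟨fun b => hne ⟨Sum.inr b⟩⟩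
    exact ⟨Equiv.equivOfIsEmpty α β, fun a => isEmptyElim a⟩
termination_by m

end Matching

section Graded

variable {K A : Type u} [Field K] [Ring A] [Algebra K A]

/-- A grading of a module, given by its system of homogeneous projections. -/
structure IsGradingProj (𝒜 : ℤ → Submodule K A) {D : Type u} [AddCommGroup D] [Module A D]
    [Module K D] (p : ℤ → D →ₗ[K] D) : Prop where
  idem : ∀ i x, p i (p i x) = p i x
  orth : ∀ i j x, i ≠ j → p i (p j x) = 0
  finite : ∃ s : Finset ℤ, (∀ i ∉ s, ∀ x, p i x = 0) ∧ ∀ x, ∑ i ∈ s, p i x = x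
  smul : ∀ i j a x, a ∈ 𝒜 i → p (i + j) (a • x) = a • p j x

/-- A submodule is homogeneous if it is stable under the homogeneous projections. -/
def IsHomogeneousFor {D : Type u} [AddCommGroup D] [Module A D] [Module K D]
    (p : ℤ → D →ₗ[K] D) (P : Submodule A D) : Prop :=
  ∀ i, ∀ x ∈ P, p i x ∈ P

/-- Nonzero graded modules without proper nonzero graded submodules. -/
structure IsGradedSimple_s10 {D : Type u} [AddCommGroup D] [Module A D] [Module K D]
    (p : ℤ → D →ₗ[K] D) : Prop where
  nontrivial : Nontrivial D
  eq_bot_or_eq_top : ∀ P : Submodule A D, IsHomogeneousFor p P → P = ⊥ ∨ P = ⊤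

/-- `d` is the largest degree in which the graded module is nonzero. -/
def IsTopDegree {D : Type u} [AddCommGroup D] [Module K D] (p : ℤ → D →ₗ[K] D) (d : ℤ) : Prop :=
  (∃ x, p d x ≠ 0) ∧ ∀ j, d < j → ∀ x, p j x = 0

namespace IsGradingProj

variable {𝒜 : ℤ → Submodule K A} {D : Type u} [AddCommGroup D] [Module A D] [Module K D]
  {D' : Type u} [AddCommGroup D'] [Module A D'] [Module K D']
  {p : ℤ → D →ₗ[K] D} {p' : ℤ → D' →ₗ[K] D'}

theorem of_surjective (hp : IsGradingProj 𝒜 p) (q : D →ₗ[A] D') (hq : Function.Surjective q)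
    (hqp : ∀ i x, q (p i x) = p' i (q x)) : IsGradingProj 𝒜 p' where
  idem i x := by
    obtain ⟨x, rfl⟩ := hq x
    rw [← hqp, ← hqp, hp.idem]
  orth i j x hij := by
    obtain ⟨x, rfl⟩ := hq x
    rw [← hqp, ← hqp, hp.orth i j x hij, map_zero]
  finite := by
    obtain ⟨s, h0, h1⟩ := hp.finite
    refine ⟨s, fun i hi x => ?_, fun x => ?_⟩
    · obtain ⟨x, rfl⟩ := hq x
      rw [← hqp, h0 i hi, map_zero]
    · obtain ⟨x, rfl⟩ := hq x
      simp_rw [← hqp]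
      rw [← map_sum, h1]
  smul i j a x ha := by
    obtain ⟨x, rfl⟩ := hq x
    rw [← hqp, ← map_smul, ← hqp, hp.smul i j a x ha, map_smul]

theorem of_injective (hp : IsGradingProj 𝒜 p) (q : D' →ₗ[A] D) (hq : Function.Injective q)
    (hqp : ∀ i x, q (p' i x) = p i (q x)) : IsGradingProj 𝒜 p' where
  idem i x := hq (by rw [hqp, hqp, hp.idem])
  orth i j x hij := hq (by rw [hqp, hqp, hp.orth i j _ hij, map_zero])
  finite := by
    obtain ⟨s, h0, h1⟩ := hp.finite
    refine ⟨s, fun i hi x => hq ?_, fun x => hq ?_⟩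
    · rw [hqp, h0 i hi, map_zero]
    · simp_rw [map_sum, hqp, h1]
  smul i j a x ha := hq (by rw [hqp, map_smul, hp.smul i j _ _ ha, map_smul, hqp])

theorem prod (hp : IsGradingProj 𝒜 p) (hp' : IsGradingProj 𝒜 p') :
    IsGradingProj 𝒜 (fun i => (p i).prodMap (p' i)) where
  idem i x := Prod.ext (hp.idem i _) (hp'.idem i _)
  orth i j x hij := Prod.ext (hp.orth i j _ hij) (hp'.orth i j _ hij)
  finite := by
    obtain ⟨s, h0, h1⟩ := hp.finite
    obtain ⟨s', h0', h1'⟩ := hp'.finite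
    classical
    refine ⟨s ∪ s', fun i hi x => ?_, fun x => ?_⟩
    · rw [Finset.notMem_union] at hi
      exact Prod.ext (h0 i hi.1 _) (h0' i hi.2 _)
    · refine Prod.ext ?_ ?_
      · rw [Prod.fst_sum]
        exact (Finset.sum_subset Finset.subset_union_left fun i _ hi => h0 i hi x.1).symm.trans
          (h1 x.1)
      · rw [Prod.snd_sum]
        exact (Finset.sum_subset Finset.subset_union_right fun i _ hi => h0' i hi x.2).symm.trans
          (h1' x.2)
  smul i j a x ha := Prod.ext (hp.smul i j _ _ ha) (hp'.smul i j _ _ ha)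

theorem exists_top_degree (hp : IsGradingProj 𝒜 p) [Nontrivial D] :
    ∃ d, IsTopDegree p d := by
  obtain ⟨s, h0, h1⟩ := hp.finite
  classical
  let t := s.filter fun i => ∃ x, p i x ≠ 0
  have ht : t.Nonempty := by
    obtain ⟨x, hx⟩ := exists_ne (0 : D)
    rw [← h1 x] at hx
    obtain ⟨i, hi, hix⟩ := Finset.exists_ne_zero_of_sum_ne_zero hx
    exact ⟨i, Finset.mem_filter.2 ⟨hi, x, hix⟩⟩
  refine ⟨t.max' ht, (Finset.mem_filter.1 (t.max'_mem ht)).2, fun j hj x => ?_⟩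
  by_contra hx
  have hjs : j ∈ s := by
    by_contra hjs
    exact hx (h0 j hjs x)
  exact absurd (t.le_max' j (Finset.mem_filter.2 ⟨hjs, x, hx⟩)) (not_le.2 hj)

/-- The homogeneous component as a module over a subalgebra concentrated in degree `0`. -/
def component (hp : IsGradingProj 𝒜 p) {T : Subalgebra K A} (hT : T.toSubmodule ≤ 𝒜 0)
    (i : ℤ) : Submodule ↥T D where
  carrier := {x | p i x = x}
  add_mem' {x y} hx hy := by
    change p i (x + y) = x + y
    rw [map_add, hx, hy]
  zero_mem' := map_zero _
  smul_mem' t x hx := by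
    have := hp.smul 0 i t x (hT t.2)
    rw [zero_add, hx] at this
    exact this

theorem mem_component (hp : IsGradingProj 𝒜 p) {T : Subalgebra K A} (hT : T.toSubmodule ≤ 𝒜 0)
    (i : ℤ) (x : D) : x ∈ hp.component hT i ↔ p i x = x := Iff.rfl

end IsGradingProj


section Triangular

variable {𝒜 : ℤ → Submodule K A} {Am T Ap : Subalgebra K A}

theorem TriangularDecomposition.eq_zero_of_mem_pos (h : TriangularDecomposition K A 𝒜 Am T Ap)
    {i : ℤ} (hi : i < 0) {y : A} (hy : y ∈ Ap) (hyi : y ∈ 𝒜 i) : y = 0 := by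
  refine Submodule.disjoint_def.1 (h.internal.submodule_iSupIndep i) y hyi ?_
  refine (iSup_le fun n : ℕ => ?_ : (⨆ n : ℕ, 𝒜 (n : ℤ)) ≤ ⨆ j, ⨆ (_ : j ≠ i), 𝒜 j)
    (h.pos_supp hy)
  exact le_iSup₂_of_le (n : ℤ) (by omega) le_rfl

variable {D : Type u} [AddCommGroup D] [Module A D]

theorem smul_mem_of_mem_span_one (U : Submodule ↥T D) {y : A}
    (hy : y ∈ Submodule.span K {(1 : A)}) {u : D} (hu : u ∈ U) : y • u ∈ U := by
  obtain ⟨c, rfl⟩ := Submodule.mem_span_singleton.1 hy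
  have := U.smul_mem (algebraMap K T c) hu
  rwa [Subalgebra.smul_def, Subalgebra.coe_algebraMap, Algebra.algebraMap_eq_smul_one] at this

variable [Module K D] {p : ℤ → D →ₗ[K] D}

/-- The submodule generated by a `T`-submodule `U` of the top component is homogeneous, and its
top component is `U`. -/
theorem IsGradingProj.apply_mem_span (hp : IsGradingProj 𝒜 p)
    (h : TriangularDecomposition K A 𝒜 Am T Ap) {d : ℤ} (hd : ∀ j, d < j → ∀ x, p j x = 0)
    (U : Submodule ↥T D) (hU : ∀ u ∈ U, p d u = u) {z : D}
    (hz : z ∈ Submodule.span A (U : Set D)) :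
    (∀ j, p j z ∈ Submodule.span A (U : Set D)) ∧ p d z ∈ U := by
  have hhom : ∀ {i : ℤ} {a : A} {u : D}, a ∈ 𝒜 i → u ∈ U → p (i + d) (a • u) = a • u :=
    fun {i a u} ha hu => by rw [hp.smul i d a u ha, hU u hu]
  have hpos : ∀ y ∈ Ap, ∀ u ∈ U, y • u ∈ U := by
    intro y hy u hu
    have hy' : y ∈ ⨆ i, Ap.toSubmodule ⊓ 𝒜 i := h.pos_graded ▸ hy
    induction hy' using Submodule.iSup_induction' with
    | mem i y hyi =>
      rcases lt_trichotomy i 0 with hi | rfl | hi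
      · rw [h.eq_zero_of_mem_pos hi hyi.1 hyi.2, zero_smul]
        exact U.zero_mem
      · exact smul_mem_of_mem_span_one U (h.pos_deg0 ▸ hyi) hu
      · rw [← hhom hyi.2 hu, hd _ (by omega)]
        exact U.zero_mem
    | zero => rw [zero_smul]; exact U.zero_mem
    | add y y' hy1 hy2 h1 h2 =>
      rw [← h.pos_graded] at hy1 hy2
      rw [add_smul]
      exact U.add_mem (h1 hy1) (h2 hy2)
  have hneg : ∀ x ∈ Am, ∀ u ∈ U,
      (∀ j, p j (x • u) ∈ Submodule.span A (U : Set D)) ∧ p d (x • u) ∈ U := by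
    intro x hx u hu
    have hx' : x ∈ ⨆ i, Am.toSubmodule ⊓ 𝒜 i := h.neg_graded ▸ hx
    clear hx
    induction hx' using Submodule.iSup_induction' with
    | mem i x hxi =>
      have key : ∀ j, j ≠ i + d → p j (x • u) = 0 := fun j hj => by
        rw [← hhom hxi.2 hu, hp.orth j _ _ hj]
      refine ⟨fun j => ?_, ?_⟩
      · by_cases hj : j = i + d
        · rw [hj, hhom hxi.2 hu]
          exact Submodule.smul_mem _ _ (Submodule.subset_span hu)
        · rw [key j hj]
          exact Submodule.zero_mem _
      · by_cases hi : i = 0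
        · subst hi
          have := hhom hxi.2 hu
          rw [zero_add] at this
          rw [this]
          exact smul_mem_of_mem_span_one U (h.neg_deg0 ▸ hxi) hu
        · rw [key d (by omega)]
          exact U.zero_mem
    | zero =>
      simp only [zero_smul, map_zero]
      exact ⟨fun _ => Submodule.zero_mem _, U.zero_mem⟩
    | add x x' _ _ h1 h2 =>
      simp only [add_smul, map_add]
      exact ⟨fun j => Submodule.add_mem _ (h1.1 j) (h2.1 j), U.add_mem h1.2 h2.2⟩
  induction hz using Submodule.closure_induction with
  | zero =>
    simp only [map_zero]
    exact ⟨fun _ => Submodule.zero_mem _, U.zero_mem⟩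
  | add x y _ _ h1 h2 =>
    simp only [map_add]
    exact ⟨fun j => Submodule.add_mem _ (h1.1 j) (h2.1 j), U.add_mem h1.2 h2.2⟩
  | smul_mem a u hu =>
    obtain ⟨w, rfl⟩ := h.mul_bij.2 a
    induction w using TensorProduct.induction_on with
    | zero =>
      simp only [map_zero, zero_smul]
      exact ⟨fun _ => Submodule.zero_mem _, U.zero_mem⟩
    | add w w' h1 h2 =>
      simp only [map_add, add_smul]
      exact ⟨fun j => Submodule.add_mem _ (h1.1 j) (h2.1 j), U.add_mem h1.2 h2.2⟩
    | tmul w y =>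
      induction w using TensorProduct.induction_on with
      | zero =>
        simp only [TensorProduct.zero_tmul, map_zero, zero_smul]
        exact ⟨fun _ => Submodule.zero_mem _, U.zero_mem⟩
      | add w w' h1 h2 =>
        simp only [TensorProduct.add_tmul, map_add, add_smul]
        exact ⟨fun j => Submodule.add_mem _ (h1.1 j) (h2.1 j), U.add_mem h1.2 h2.2⟩
      | tmul x t =>
        have he : triMulMap K A Am.toSubmodule T.toSubmodule Ap.toSubmodule ((x ⊗ₜ t) ⊗ₜ y) • u =
            (x : A) • ((⟨t, t.2⟩ : T) • ((y : A) • u)) := by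
          rw [Subalgebra.smul_def, ← mul_smul, ← mul_smul]
          simp [triMulMap, mulMap, mul_assoc]
        rw [he]
        exact hneg x x.2 _ (U.smul_mem _ (hpos y y.2 u hu))


theorem IsGradedSimple_s10.isSimpleModule_component (hs : IsGradedSimple_s10 (A := A) p)
    (hp : IsGradingProj 𝒜 p) (h : TriangularDecomposition K A 𝒜 Am T Ap) {d : ℤ}
    (hd : IsTopDegree p d) : IsSimpleModule ↥T (hp.component h.T_deg0 d) := by
  obtain ⟨⟨x, hx⟩, hd⟩ := hd
  have hnt : Nontrivial (hp.component h.T_deg0 d) :=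
    ⟨⟨⟨p d x, hp.idem d x⟩, 0, fun h0 => hx (congrArg Subtype.val h0)⟩⟩
  rw [isSimpleModule_iff]
  refine { eq_bot_or_eq_top := fun V => ?_ }
  let U := V.map (hp.component h.T_deg0 d).subtype
  have hU : ∀ u ∈ U, p d u = u := by
    rintro _ ⟨v, -, rfl⟩
    exact v.2
  have hZ := fun z hz => hp.apply_mem_span h hd U hU (z := z) hz
  rcases hs.eq_bot_or_eq_top (Submodule.span A (U : Set D)) fun i x hx => (hZ x hx).1 i with h0 | h1
  · left
    rw [Submodule.span_eq_bot] at h0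
    rw [eq_bot_iff]
    intro v hv
    exact Subtype.ext (h0 v ⟨v, hv, rfl⟩)
  · right
    rw [eq_top_iff]
    intro v _
    have := (hZ v (h1 ▸ Submodule.mem_top)).2
    rw [(hp.mem_component h.T_deg0 d v).1 v.2] at this
    obtain ⟨w, hw, hwv⟩ := this
    rwa [← Subtype.ext hwv]

variable {D' : Type u} [AddCommGroup D'] [Module A D'] [Module K D'] {p' : ℤ → D' →ₗ[K] D'}

omit [Algebra K A] in
theorem IsGradedSimple_s10.bijective_domRestrict {E : Type u} [AddCommGroup E] [Module A E]
    [Module K E] {q : ℤ → E →ₗ[K] E}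
    (hs : IsGradedSimple_s10 (A := A) p) (hs' : IsGradedSimple_s10 (A := A) p') (f : E →ₗ[A] D)
    (g : E →ₗ[A] D') (hf : ∀ i x, f (q i x) = p i (f x)) (hg : ∀ i x, g (q i x) = p' i (g x))
    (hfg : ∀ x, f x = 0 → g x = 0 → x = 0) {Z : Submodule A E} (hZ : IsHomogeneousFor q Z)
    {d : ℤ} (hd : ∃ x, p' d x ≠ 0) (hp' : ∀ x, p' d (p' d x) = p' d x)
    (hZd : ∀ z ∈ Z, f (q d z) = 0 → q d z = 0) (hZf : ∃ z ∈ Z, f z ≠ 0) :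
    Function.Bijective (f.domRestrict Z) := by
  constructor
  · rw [← LinearMap.ker_eq_bot, eq_bot_iff]
    rintro ⟨z, hz⟩ (hfz : f z = 0)
    rcases hs'.eq_bot_or_eq_top ((Z ⊓ LinearMap.ker f).map g) (by
      rintro i _ ⟨z, ⟨hz, hfz⟩, rfl⟩
      refine ⟨q i z, ⟨hZ i z hz, ?_⟩, hg i z⟩
      change f (q i z) = 0
      rw [hf, show f z = 0 from hfz, map_zero]) with h0 | h1
    · refine Subtype.ext (hfg z hfz ?_)
      have : g z ∈ (Z ⊓ LinearMap.ker f).map g := ⟨z, ⟨hz, hfz⟩, rfl⟩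
      rwa [h0] at this
    · obtain ⟨x, hx⟩ := hd
      obtain ⟨w, ⟨hw, hfw⟩, hgw⟩ : p' d x ∈ (Z ⊓ LinearMap.ker f).map g := h1 ▸ Submodule.mem_top
      have : q d w = 0 := hZd w hw (by rw [hf, show f w = 0 from hfw, map_zero])
      refine absurd ?_ hx
      rw [← hp', ← hgw, ← hg, this, map_zero]
  · rw [← LinearMap.range_eq_top, LinearMap.range_domRestrict]
    refine (hs.eq_bot_or_eq_top (Z.map f) ?_).resolve_left ?_
    · rintro i _ ⟨z, hz, rfl⟩
      exact ⟨q i z, hZ i z hz, hf i z⟩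
    · obtain ⟨z, hz, hfz⟩ := hZf
      intro h0
      exact hfz (by simpa [h0] using Submodule.mem_map_of_mem (f := f) hz)

/-- A graded simple module is determined by its top component. -/
theorem IsGradedSimple_s10.exists_equiv (hs : IsGradedSimple_s10 (A := A) p)
    (hs' : IsGradedSimple_s10 (A := A) p') (hp : IsGradingProj 𝒜 p) (hp' : IsGradingProj 𝒜 p')
    (h : TriangularDecomposition K A 𝒜 Am T Ap) {d : ℤ} (hd : IsTopDegree p d)
    (hd' : IsTopDegree p' d)
    (φ : hp.component h.T_deg0 d ≃ₗ[↥T] hp'.component h.T_deg0 d) :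
    ∃ e : D ≃ₗ[A] D', ∀ i x, e (p i x) = p' i (e x) := by
  let U : Submodule ↥T (D × D') := LinearMap.range ((hp.component h.T_deg0 d).subtype.prod
    ((hp'.component h.T_deg0 d).subtype.comp φ.toLinearMap))
  let Z := Submodule.span A (U : Set (D × D'))
  let q : ℤ → D × D' →ₗ[K] D × D' := fun i => (p i).prodMap (p' i)
  have hq : IsGradingProj 𝒜 q := hp.prod hp'
  have hU : ∀ u ∈ U, q d u = u := by
    rintro _ ⟨v, rfl⟩
    exact Prod.ext v.2 (φ v).2
  have hZ := fun z hz => hq.apply_mem_span h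
    (fun j hj x => Prod.ext (hd.2 j hj _) (hd'.2 j hj _)) U hU (z := z) hz
  have hZh : IsHomogeneousFor q Z := fun i x hx => (hZ x hx).1 i
  obtain ⟨x, hx⟩ := hd.1
  let v : hp.component h.T_deg0 d := ⟨p d x, hp.idem d x⟩
  have hv : v ≠ 0 := fun h0 => hx (congrArg Subtype.val h0)
  have hvZ : ((v : D), (φ v : D')) ∈ Z := Submodule.subset_span ⟨v, rfl⟩
  have hF := IsGradedSimple_s10.bijective_domRestrict hs hs' (LinearMap.fst A D D')
    (LinearMap.snd A D D') (fun _ _ => rfl) (fun _ _ => rfl) (fun x h1 h2 => Prod.ext h1 h2) hZh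
    hd'.1 (hp'.idem d) (by
      intro z hz h0
      obtain ⟨w, hw⟩ := (hZ z hz).2
      rw [← hw] at h0 ⊢
      have : w = 0 := Subtype.ext h0
      rw [this, map_zero])
    ⟨_, hvZ, hx⟩
  have hG := IsGradedSimple_s10.bijective_domRestrict hs' hs (LinearMap.snd A D D')
    (LinearMap.fst A D D') (fun _ _ => rfl) (fun _ _ => rfl) (fun x h1 h2 => Prod.ext h2 h1) hZh
    hd.1 (hp.idem d) (by
      intro z hz h0
      obtain ⟨w, hw⟩ := (hZ z hz).2
      rw [← hw] at h0 ⊢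
      have : w = 0 := φ.map_eq_zero_iff.1 (Subtype.ext h0)
      rw [this, map_zero])
    ⟨_, hvZ, fun h0 => hv (φ.map_eq_zero_iff.1 (Subtype.ext h0))⟩
  let eF := LinearEquiv.ofBijective _ hF
  let eG := LinearEquiv.ofBijective _ hG
  refine ⟨eF.symm.trans eG, fun i x => ?_⟩
  obtain ⟨z, rfl⟩ := eF.surjective x
  have h1 : p i (eF z) = eF ⟨q i z, hZh i z z.2⟩ := rfl
  rw [h1, LinearEquiv.trans_apply, LinearEquiv.trans_apply, eF.symm_apply_apply,
    eF.symm_apply_apply]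
  rfl

/-- Some idempotent of `T` acts nontrivially on the top component of a given graded simple module
and kills the corresponding component of every other one with no larger degrees. -/
theorem IsGradedSimple_s10.exists_idempotent [FiniteDimensional K A]
    (hs : IsGradedSimple_s10 (A := A) p) (hp : IsGradingProj 𝒜 p)
    (h : TriangularDecomposition K A 𝒜 Am T Ap) {d : ℤ} (hd : IsTopDegree p d) :
    ∃ e : ↥T, IsIdempotentElem e ∧ (∃ x, p d x = x ∧ (e : A) • x ≠ 0) ∧
      ∀ (D' : Type u) [AddCommGroup D'] [Module A D'] [Module K D'] (p' : ℤ → D' →ₗ[K] D'),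
        IsGradingProj 𝒜 p' → IsGradedSimple_s10 (A := A) p' → ∀ d', IsTopDegree p' d' → d' ≤ d →
        (∃ x, p' d x = x ∧ (e : A) • x ≠ 0) →
        ∃ f : D ≃ₗ[A] D', ∀ i x, f (p i x) = p' i (f x) := by
  have : IsArtinianRing ↥T := IsArtinianRing.of_finite K ↥T
  have := hs.isSimpleModule_component hp h hd
  obtain ⟨e, he, ⟨v, hv⟩, hW⟩ := exists_idempotent_detecting_simple (R := ↥T)
    (hp.component h.T_deg0 d)
  refine ⟨e, he, ⟨v, v.2, fun h0 => hv (Subtype.ext h0)⟩, ?_⟩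
  rintro D' _ _ _ p' hp' hs' d' hd' hle ⟨x, hx, hex⟩
  obtain rfl : d' = d := by
    refine le_antisymm hle (not_lt.1 fun hlt => hex ?_)
    rw [← hx, hd'.2 d hlt, smul_zero]
  obtain ⟨φ⟩ := hW _ (hs'.isSimpleModule_component hp' h hd')
    ⟨⟨x, hx⟩, fun h0 => hex (congrArg Subtype.val h0)⟩
  exact hs.exists_equiv hs' hp hp' h hd hd' φ

end Triangular

section Filtration

variable {𝒜 : ℤ → Submodule K A}

theorem IsModuleGrading.exists_isGradingProj {M : Type u} [AddCommGroup M] [Module A M]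
    [Module K M] [IsScalarTower K A M] [FiniteDimensional K M] {ℳ : ℤ → Submodule K M}
    (h : IsModuleGrading K A 𝒜 ℳ) :
    ∃ p : ℤ → M →ₗ[K] M, IsGradingProj 𝒜 p ∧ ∀ i x, x ∈ ℳ i ↔ p i x = x := by
  obtain ⟨hint, hsmul⟩ := h
  let _ : DirectSum.Decomposition ℳ := hint.chooseDecomposition
  let p : ℤ → M →ₗ[K] M := fun i => (ℳ i).subtype ∘ₗ DirectSum.component K ℤ (fun i => ℳ i) i ∘ₗ
    (DirectSum.decomposeLinearEquiv ℳ).toLinearMap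
  have hp : ∀ i x, p i x = DirectSum.decompose ℳ x i := fun _ _ => rfl
  have hmem : ∀ i x, p i x ∈ ℳ i := fun i x => (DirectSum.decompose ℳ x i).2
  have hsame : ∀ i x, x ∈ ℳ i → p i x = x := fun i x hx => DirectSum.decompose_of_mem_same ℳ hx
  have hne : ∀ i j x, i ≠ j → x ∈ ℳ j → p i x = 0 := fun i j x hij hx =>
    DirectSum.decompose_of_mem_ne ℳ hx hij.symm
  have hfin : {i | ℳ i ≠ ⊥}.Finite :=
    WellFoundedGT.finite_ne_bot_of_iSupIndep hint.submodule_iSupIndep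
  have h0 : ∀ i ∉ hfin.toFinset, ∀ x, p i x = 0 := by
    intro i hi x
    rw [Set.Finite.mem_toFinset, Set.mem_ofPred_eq, not_not] at hi
    have := hmem i x
    rwa [hi, Submodule.mem_bot] at this
  have h1 : ∀ x, ∑ i ∈ hfin.toFinset, p i x = x := by
    classical
    intro x
    conv_rhs => rw [← DirectSum.sum_support_decompose ℳ x]
    refine (Finset.sum_subset (fun i hi => ?_) fun i _ hi => ?_).symm
    · by_contra hi'
      exact (DFinsupp.mem_support_iff.1 hi) (Subtype.ext (h0 i hi' x))
    · rw [DFinsupp.notMem_support_iff] at hi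
      exact congrArg Subtype.val hi
  refine ⟨p, ⟨fun i x => hsame i _ (hmem i x), fun i j x hij => hne i j _ hij (hmem j x),
    ⟨_, h0, h1⟩, fun i j a x ha => ?_⟩, fun i x => ⟨hsame i x, fun hx => hx ▸ hmem i x⟩⟩
  have key : ∀ k, p (i + j) (a • p k x) = if k = j then a • p k x else 0 := by
    intro k
    split_ifs with hk
    · subst hk
      exact hsame _ _ (hsmul _ _ _ _ ha (hmem k x))
    · exact hne _ (i + k) _ (by omega) (hsmul _ _ _ _ ha (hmem k x))
  conv_lhs => rw [← h1 x, Finset.smul_sum, map_sum]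
  simp_rw [key]
  rw [Finset.sum_ite_eq']
  split_ifs with hj
  · rfl
  · rw [h0 j hj, smul_zero]

variable {M : Type u} [AddCommGroup M] [Module A M] [Module K M] [IsScalarTower K A M]
  {p : ℤ → M →ₗ[K] M}

theorem exists_subquotient_proj {P Q : Submodule A M} (hP : IsHomogeneousFor p P)
    (hQ : IsHomogeneousFor p Q) :
    ∃ p' : ℤ → (↥Q ⧸ Submodule.comap Q.subtype P) →ₗ[K] (↥Q ⧸ Submodule.comap Q.subtype P),
      ∀ i (x : Q), p' i ((Submodule.comap Q.subtype P).mkQ x) =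
        (Submodule.comap Q.subtype P).mkQ ⟨p i x, hQ i x x.2⟩ := by
  let S := Submodule.comap Q.subtype P
  let r : ℤ → Q →ₗ[K] Q := fun i => (p i).restrict (p := Q.restrictScalars K)
    (q := Q.restrictScalars K) fun x hx => hQ i x hx
  let E := Submodule.Quotient.restrictScalarsEquiv K S
  refine ⟨fun i => E.toLinearMap ∘ₗ
    (S.restrictScalars K).mapQ (S.restrictScalars K) (r i) (fun x hx => hP i x hx) ∘ₗ
      E.symm.toLinearMap, fun i x => rfl⟩

theorem mem_subquotientImage_iff {ℳ : ℤ → Submodule K M} (hp : IsGradingProj 𝒜 p)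
    (hℳ : ∀ i x, x ∈ ℳ i ↔ p i x = x) {P Q : Submodule A M} (hQ : IsHomogeneousFor p Q)
    {p' : ℤ → (↥Q ⧸ Submodule.comap Q.subtype P) →ₗ[K] (↥Q ⧸ Submodule.comap Q.subtype P)}
    (hp' : ∀ i (x : Q), p' i ((Submodule.comap Q.subtype P).mkQ x) =
      (Submodule.comap Q.subtype P).mkQ ⟨p i x, hQ i x x.2⟩) (i : ℤ)
    (x : ↥Q ⧸ Submodule.comap Q.subtype P) :
    x ∈ subquotientImage P Q (ℳ i) ↔ p' i x = x := by
  constructor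
  · rintro ⟨y, hy, rfl⟩
    refine (hp' i y).trans (congrArg _ (Subtype.ext ?_))
    exact (hℳ i y).1 hy
  · intro hx
    obtain ⟨y, rfl⟩ := Submodule.mkQ_surjective _ x
    rw [hp'] at hx
    exact ⟨⟨p i y, hQ i y y.2⟩, (hℳ i _).2 (hp.idem i _), hx⟩

/-- Graded modules of finite length have graded composition series. -/
theorem exists_graded_compositionSeries [FiniteDimensional K M] (hp : IsGradingProj 𝒜 p)
    {ℳ : ℤ → Submodule K M} (hℳ : ∀ i x, x ∈ ℳ i ↔ p i x = x) :
    ∃ (n : ℕ) (F : Fin (n + 1) → Submodule A M)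
      (p' : ∀ k : Fin n, ℤ →
        (↥(F k.succ) ⧸ Submodule.comap (F k.succ).subtype (F k.castSucc)) →ₗ[K]
          (↥(F k.succ) ⧸ Submodule.comap (F k.succ).subtype (F k.castSucc))),
      Monotone F ∧ F 0 = ⊥ ∧ F (Fin.last n) = ⊤ ∧
      ∀ k, IsGradingProj 𝒜 (p' k) ∧ IsGradedSimple_s10 (A := A) (p' k) ∧
        ∀ i x, x ∈ subquotientImage (F k.castSucc) (F k.succ) (ℳ i) ↔ p' k i x = x := by
  have : IsNoetherian A M := isNoetherian_of_tower K inferInstance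
  have : IsArtinian A M := isArtinian_of_tower K inferInstance
  let α := {P : Submodule A M // IsHomogeneousFor p P}
  let b : α := ⟨⊥, fun i x hx => by rw [(Submodule.mem_bot A).1 hx, map_zero]; exact zero_mem _⟩
  let t : α := ⟨⊤, fun _ _ _ => trivial⟩
  have : Nonempty α := ⟨b⟩
  obtain ⟨a, h0, n, h1, hcov⟩ := exists_covBy_seq_of_wellFoundedLT_wellFoundedGT α
  choose p' hp' using fun k : Fin n =>
    exists_subquotient_proj (a (k.castSucc : Fin (n + 1))).2 (a (k.succ : Fin (n + 1))).2
  refine ⟨n, fun k => (a k).1, p', ?_, ?_, ?_, fun k => ⟨?_, ⟨?_, fun N hN => ?_⟩,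
    mem_subquotientImage_iff hp hℳ (a (k.succ : Fin (n + 1))).2 (hp' k)⟩⟩
  · rw [Fin.monotone_iff_le_succ]
    intro k
    exact (hcov k k.2).le
  · exact le_bot_iff.1 (h0 (show b ≤ a 0 from bot_le (a := (a 0).1)))
  · exact top_le_iff.1 (h1 (show a n ≤ t from le_top (a := (a n).1)))
  · let Q := (a (k.succ : Fin (n + 1)))
    let r : ℤ → Q.1 →ₗ[K] Q.1 := fun i => (p i).restrict (p := Q.1.restrictScalars K)
      (q := Q.1.restrictScalars K) fun x hx => Q.2 i x hx
    have hr : IsGradingProj 𝒜 r :=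
      hp.of_injective Q.1.subtype Subtype.val_injective fun _ _ => rfl
    exact hr.of_surjective (Submodule.mkQ _) (Submodule.mkQ_surjective _)
      fun i x => (hp' k i x).symm
  · rw [Submodule.Quotient.nontrivial_iff]
    intro htop
    refine (hcov k k.2).lt.not_ge ?_
    rwa [Submodule.comap_subtype_eq_top] at htop
  · let P := a k
    let Q := a (k + 1)
    have hPQ : P ≤ Q := (hcov k k.2).le
    let q := (Submodule.comap Q.1.subtype P.1).mkQ
    have hq : ∀ i (x : Q.1), p' k i (q x) = q ⟨p i x, Q.2 i x x.2⟩ := hp' k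
    let L : α := ⟨(N.comap q).map Q.1.subtype, by
      rintro i _ ⟨y, hy, rfl⟩
      refine ⟨⟨p i y, Q.2 i y y.2⟩, ?_, rfl⟩
      change q _ ∈ N
      rw [← hq]
      exact hN i _ hy⟩
    have hPL : P ≤ L := fun x hx => ⟨⟨x, hPQ hx⟩, by
      change q _ ∈ N
      rw [show q ⟨x, hPQ hx⟩ = 0 from (Submodule.Quotient.mk_eq_zero _).2 hx]
      exact N.zero_mem, rfl⟩
    have hLQ : L ≤ Q := Submodule.map_subtype_le _ _
    rcases (hcov k k.2).eq_or_eq hPL hLQ with hL | hL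
    · left
      rw [eq_bot_iff]
      intro x hx
      obtain ⟨y, rfl⟩ := Submodule.mkQ_surjective _ x
      have hy : (y : M) ∈ L.1 := ⟨y, hx, rfl⟩
      rw [hL] at hy
      exact (Submodule.Quotient.mk_eq_zero _).2 hy
    · right
      rw [eq_top_iff]
      intro x _
      obtain ⟨y, rfl⟩ := Submodule.mkQ_surjective _ x
      have hy : (y : M) ∈ L.1 := by
        rw [hL]
        exact y.2
      obtain ⟨z, hz, hzy⟩ := hy
      rwa [← show z = y from Subtype.ext hzy]

end Filtration

section Comparison

theorem smulRank_ne_zero_iff {X : Type u} [AddCommGroup X] [Module A X] [Module K X]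
    [IsScalarTower K A X] [FiniteDimensional K X] (e : A) (W : Submodule K X) :
    smulRank K e W ≠ 0 ↔ ∃ x ∈ W, e • x ≠ 0 := by
  rw [smulRank, Ne, Submodule.finrank_eq_zero, ← le_bot_iff, Submodule.map_le_iff_le_comap]
  exact Set.not_subset

omit [Algebra K A] in
theorem image_eq_of_intertwining {X Y : Type u} [AddCommGroup X] [Module A X] [Module K X]
    [AddCommGroup Y] [Module A Y] [Module K Y] {W : Submodule K X} {W' : Submodule K Y}
    {p : X →ₗ[K] X} {p' : Y →ₗ[K] Y} (hW : ∀ x, x ∈ W ↔ p x = x) (hW' : ∀ x, x ∈ W' ↔ p' x = x)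
    (f : X ≃ₗ[A] Y) (hf : ∀ x, f (p x) = p' (f x)) : f '' (W : Set X) = W' := by
  ext y
  constructor
  · rintro ⟨x, hx, rfl⟩
    refine (hW' _).2 ?_
    rw [← hf, (hW x).1 hx]
  · intro hy
    obtain ⟨x, rfl⟩ := f.surjective y
    refine ⟨x, (hW x).2 (f.injective ?_), rfl⟩
    rw [hf]
    exact (hW' _).1 hy

theorem smulRank_eq_of_image_eq {X Y : Type u} [AddCommGroup X] [Module A X] [Module K X]
    [IsScalarTower K A X] [AddCommGroup Y] [Module A Y] [Module K Y] [IsScalarTower K A Y]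
    {W : Submodule K X} {W' : Submodule K Y} (f : X ≃ₗ[A] Y) (h : f '' (W : Set X) = W') (e : A) :
    smulRank K e W = smulRank K e W' := by
  rw [← smulRank_map_of_injective e f.toLinearMap f.injective]
  congr 1
  exact SetLike.coe_injective h

theorem smulRank_restrictScalars {T : Subalgebra K A} {X : Type u} [AddCommGroup X] [Module A X]
    [Module K X] [IsScalarTower K A X] (e : ↥T) (V : Submodule ↥T X) :
    smulRank K e (⊤ : Submodule K ↥V) = smulRank K (e : A) (V.restrictScalars K) := by
  rw [← smulRank_map_of_injective e V.subtype Subtype.val_injective]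
  have : (⊤ : Submodule K ↥V).map (V.subtype.restrictScalars K) = V.restrictScalars K := by
    ext x
    constructor
    · rintro ⟨y, -, rfl⟩
      exact y.2
    · exact fun hx => ⟨⟨x, hx⟩, trivial, rfl⟩
  rw [this]
  rfl

/-- Two families of finite-dimensional graded simple modules with the same graded `T`-characters
agree up to a permutation and graded isomorphisms. -/
theorem exists_equiv_of_sum_smulRank_eq [FiniteDimensional K A]
    {𝒜 : ℤ → Submodule K A} {Am T Ap : Subalgebra K A}
    (h : TriangularDecomposition K A 𝒜 Am T Ap) {m n : ℕ} (X : Fin m → Type u)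
    (Y : Fin n → Type u) [∀ k, AddCommGroup (X k)] [∀ k, Module A (X k)] [∀ k, Module K (X k)]
    [∀ k, IsScalarTower K A (X k)] [∀ k, FiniteDimensional K (X k)]
    [∀ l, AddCommGroup (Y l)] [∀ l, Module A (Y l)] [∀ l, Module K (Y l)]
    [∀ l, IsScalarTower K A (Y l)] [∀ l, FiniteDimensional K (Y l)]
    {p : ∀ k, ℤ → X k →ₗ[K] X k} {q : ∀ l, ℤ → Y l →ₗ[K] Y l}
    (hp : ∀ k, IsGradingProj 𝒜 (p k)) (hq : ∀ l, IsGradingProj 𝒜 (q l))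
    (hps : ∀ k, IsGradedSimple_s10 (A := A) (p k)) (hqs : ∀ l, IsGradedSimple_s10 (A := A) (q l))
    (V : ∀ k, ℤ → Submodule K (X k)) (W : ∀ l, ℤ → Submodule K (Y l))
    (hV : ∀ k i x, x ∈ V k i ↔ p k i x = x) (hW : ∀ l i x, x ∈ W l i ↔ q l i x = x)
    (hsum : ∀ (e : {e : ↥T // IsIdempotentElem e}) (i : ℤ),
      ∑ k, smulRank K (e.1 : A) (V k i) = ∑ l, smulRank K (e.1 : A) (W l i)) :
    ∃ σ : Fin m ≃ Fin n, ∀ k, ∃ f : X k ≃ₗ[A] Y (σ k),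
      ∀ i, f '' (V k i : Set (X k)) = W (σ k) i := by
  have hdX : ∀ k, ∃ d, IsTopDegree (p k) d := fun k => by
    have := (hps k).nontrivial
    exact (hp k).exists_top_degree
  have hdY : ∀ l, ∃ d, IsTopDegree (q l) d := fun l => by
    have := (hqs l).nontrivial
    exact (hq l).exists_top_degree
  choose d hd using hdX
  choose d' hd' using hdY
  obtain ⟨σ, hσ⟩ := exists_equiv_of_sum_eq m (Fintype.card_fin m) d d'
    (fun (e : {e : ↥T // IsIdempotentElem e}) i k => smulRank K (e.1 : A) (V k i))
    (fun e i l => smulRank K (e.1 : A) (W l i))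
    (fun k l => ∃ f : X k ≃ₗ[A] Y l, ∀ i x, f (p k i x) = q l i (f x))
    (fun k => by
      obtain ⟨e, he, ⟨x, hx, hex⟩, h'⟩ := (hps k).exists_idempotent (hp k) h (hd k)
      refine ⟨⟨e, he⟩, (smulRank_ne_zero_iff _ _).2 ⟨x, (hV k _ x).2 hx, hex⟩,
        fun l hl hne => ?_⟩
      obtain ⟨y, hy, hey⟩ := (smulRank_ne_zero_iff _ _).1 hne
      exact h' _ (q l) (hq l) (hqs l) _ (hd' l) hl ⟨y, (hW l _ y).1 hy, hey⟩)
    (fun l => by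
      obtain ⟨e, he, ⟨x, hx, hex⟩, h'⟩ := (hqs l).exists_idempotent (hq l) h (hd' l)
      refine ⟨⟨e, he⟩, (smulRank_ne_zero_iff _ _).2 ⟨x, (hW l _ x).2 hx, hex⟩,
        fun k hk hne => ?_⟩
      obtain ⟨y, hy, hey⟩ := (smulRank_ne_zero_iff _ _).1 hne
      obtain ⟨f, hf⟩ := h' _ (p k) (hp k) (hps k) _ (hd k) hk ⟨y, (hV k _ y).1 hy, hey⟩
      exact ⟨f.symm, fun i x => f.injective (by
        rw [hf, f.apply_symm_apply, f.apply_symm_apply])⟩)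
    (fun k l ⟨f, hf⟩ e i => smulRank_eq_of_image_eq f
      (image_eq_of_intertwining (hV k i) (hW l i) f (hf i)) e.1)
    hsum
  refine ⟨σ, fun k => ?_⟩
  obtain ⟨f, hf⟩ := hσ k
  exact ⟨f, fun i => image_eq_of_intertwining (hV k i) (hW (σ k) i) f (hf i)⟩

theorem finiteDimensional_subquotient {M : Type u} [AddCommGroup M] [Module A M] [Module K M]
    [IsScalarTower K A M] [FiniteDimensional K M] (P Q : Submodule A M) :
    FiniteDimensional K (↥Q ⧸ Submodule.comap Q.subtype P) := by
  have : FiniteDimensional K Q :=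
    FiniteDimensional.of_injective (Q.subtype.restrictScalars K) Subtype.val_injective
  infer_instance

end Comparison

end Graded

/-- The restriction map `χ : K₀(𝒢(A)) → K₀(𝒢(T))` is injective:
if two finitely generated graded `A`-modules have, degreewise, the same class in
`K₀` of `T`-modules, then they have the same class in `K₀` of graded `A`-modules
(equality of classes being expressed by matching filtrations).  Injectivity on
arbitrary (virtual) classes follows since every class is a difference of classes of
modules. -/
theorem graded_character_injective (K A : Type u) [Field K] [Ring A] [Algebra K A]
    [FiniteDimensional K A] (𝒜 : ℤ → Submodule K A) (Am T Ap : Subalgebra K A)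
    (h : TriangularDecomposition K A 𝒜 Am T Ap)
    (M N : Type u) [AddCommGroup M] [Module A M] [Module K M] [IsScalarTower K A M]
    [Module.Finite A M]
    [AddCommGroup N] [Module A N] [Module K N] [IsScalarTower K A N] [Module.Finite A N]
    (ℳ : ℤ → Submodule ↥T M) (𝒩 : ℤ → Submodule ↥T N)
    (hℳ : IsModuleGrading K A 𝒜 (fun i => (ℳ i).restrictScalars K))
    (h𝒩 : IsModuleGrading K A 𝒜 (fun i => (𝒩 i).restrictScalars K))
    -- `M` and `N` have the same graded `T`-character, i.e. `χ [M] = χ [N]`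
    (hchar : ∀ i : ℤ, MatchingFactors ↥T ↥(ℳ i) ↥(𝒩 i)) :
    -- then `[M] = [N]` in `K₀(𝒢(A))`
    GradedMatchingFactors K A (fun i => (ℳ i).restrictScalars K)
      (fun i => (𝒩 i).restrictScalars K) := by
  have : FiniteDimensional K M := Module.Finite.trans A M
  have : FiniteDimensional K N := Module.Finite.trans A N
  obtain ⟨p, hp, hpℳ⟩ := hℳ.exists_isGradingProj
  obtain ⟨q, hq, hq𝒩⟩ := h𝒩.exists_isGradingProj
  obtain ⟨m, F, p', hF, hF0, hF1, hFs⟩ := exists_graded_compositionSeries hp hpℳ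
  obtain ⟨n, G, q', hG, hG0, hG1, hGs⟩ := exists_graded_compositionSeries hq hq𝒩
  choose hp' hps hpW using hFs
  choose hq' hqs hqW using hGs
  have hsum : ∀ (e : {e : ↥T // IsIdempotentElem e}) (i : ℤ),
      ∑ k : Fin m, smulRank K (e.1 : A)
        (subquotientImage (F k.castSucc) (F k.succ) ((ℳ i).restrictScalars K)) =
      ∑ k : Fin n, smulRank K (e.1 : A)
        (subquotientImage (G k.castSucc) (G k.succ) ((𝒩 i).restrictScalars K)) := by
    intro e i
    have he : IsIdempotentElem (e.1 : A) := congrArg Subtype.val e.2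
    rw [← smulRank_eq_sum he _ (fun x hx => (ℳ i).smul_mem e.1 hx) F hF hF0 hF1,
      ← smulRank_eq_sum he _ (fun x hx => (𝒩 i).smul_mem e.1 hx) G hG hG0 hG1,
      ← smulRank_restrictScalars, ← smulRank_restrictScalars]
    have : FiniteDimensional K ↥(ℳ i) :=
      FiniteDimensional.of_injective ((ℳ i).subtype.restrictScalars K) Subtype.val_injective
    have : FiniteDimensional K ↥(𝒩 i) :=
      FiniteDimensional.of_injective ((𝒩 i).subtype.restrictScalars K) Subtype.val_injective
    exact (hchar i).smulRank_eq e.2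
  have := fun k : Fin m => finiteDimensional_subquotient (K := K) (F k.castSucc) (F k.succ)
  have := fun l : Fin n => finiteDimensional_subquotient (K := K) (G l.castSucc) (G l.succ)
  obtain ⟨σ, hσ⟩ := exists_equiv_of_sum_smulRank_eq h
    (fun k : Fin m => ↥(F k.succ) ⧸ Submodule.comap (F k.succ).subtype (F k.castSucc))
    (fun l : Fin n => ↥(G l.succ) ⧸ Submodule.comap (G l.succ).subtype (G l.castSucc))
    hp' hq' hps hqs
    (fun k i => subquotientImage (F k.castSucc) (F k.succ) ((ℳ i).restrictScalars K))
    (fun l i => subquotientImage (G l.castSucc) (G l.succ) ((𝒩 i).restrictScalars K))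
    hpW hqW hsum
  obtain rfl : m = n := by simpa using Fintype.card_congr σ
  exact ⟨m, F, G, σ, hF, hG, hF0, hF1, hG0, hG1, hσ⟩


end TriangularPaper
end
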